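/- arXiv:2411.15578 — 2 statements merged into one kernel-verified Lean document; each statement's English description precedes it below -/
import Mathlib

section
/- Let Re(λ) > log 2. Then the spectrum of the resolvent R(λ, log 𝒞) of the generator log 𝒞 of the Hölder semigroup on L²(ℝ) is σ(R(λ, log 𝒞)) = {1/(λ + log(1/2 − is)) : s ∈ ℝ} ∪ {0}, where log denotes the principal branch of the logarithm. -/
open MeasureTheory Complex Filter

noncomputable section

/-- `L²(ℝ)` with complex values. -/
abbrev L2 : Type := MeasureTheory.Lp ℂ 2 (MeasureTheory.volume : MeasureTheory.Measure ℝ)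

/-- `T` is the Hausdorff operator with kernel `K`:
`(T f)(x) = ∫_ℝ K(u) f(ux) du`. -/
def IsHausdorffOp (K : ℝ → ℂ) (T : L2 →L[ℂ] L2) : Prop :=
  ∀ f : L2, ∀ᵐ x : ℝ ∂MeasureTheory.volume, T f x = ∫ u : ℝ, K u * f (u * x)

/-- The kernel `(1/Γ(α)) (log(1/u))^{α-1} χ_{(0,1)}(u)` of the Hölder operator `H_α`. -/
def holderKernel (α : ℂ) : ℝ → ℂ := fun u =>
  if u ∈ Set.Ioo (0:ℝ) 1 then (Complex.Gamma α)⁻¹ * ((Real.log u⁻¹ : ℝ) : ℂ) ^ (α - 1) else 0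

/-- The (generally unbounded, partially defined) operator `A` is the infinitesimal
generator of the one-parameter family `T` of bounded operators. -/
def IsGeneratorOf (T : ℝ → (L2 →L[ℂ] L2)) (A : L2 →ₗ.[ℂ] L2) : Prop :=
  ∀ f : L2,
    (f ∈ A.domain ↔ ∃ g : L2,
      Filter.Tendsto (fun t : ℝ => (t : ℂ)⁻¹ • (T t f - f))
        (nhdsWithin 0 (Set.Ioi 0)) (nhds g)) ∧
    ∀ hf : f ∈ A.domain,
      Filter.Tendsto (fun t : ℝ => (t : ℂ)⁻¹ • (T t f - f))
        (nhdsWithin 0 (Set.Ioi 0)) (nhds (A ⟨f, hf⟩))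

/-- `R` is the resolvent `(z I - A)⁻¹` of the partially defined operator `A`. -/
def IsResolventOf (A : L2 →ₗ.[ℂ] L2) (z : ℂ) (R : L2 →L[ℂ] L2) : Prop :=
  (∀ f : L2, ∃ hf : R f ∈ A.domain, z • (R f) - A ⟨R f, hf⟩ = f) ∧
  (∀ f : L2, ∀ hf : f ∈ A.domain, R (z • f - A ⟨f, hf⟩) = f)

lemma mpDil (u : ℝ) (hu : 0 < u) : MeasurePreserving (fun x : ℝ => u * x) volume
    (ENNReal.ofReal u⁻¹ • (volume : Measure ℝ)) := by
  refine ⟨by fun_prop, ?_⟩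
  rw [Real.map_volume_mul_left hu.ne', abs_of_pos (inv_pos.2 hu)]

lemma qmpDil (u : ℝ) (hu : u ≠ 0) :
    Measure.QuasiMeasurePreserving (fun x : ℝ => u * x) volume volume := by
  refine ⟨by fun_prop, ?_⟩
  rw [Real.map_volume_mul_left hu]
  exact Measure.smul_absolutelyContinuous

lemma memLp_dil (u : ℝ) (hu : 0 < u) (f : L2) :
    MemLp (fun x => f (u * x)) 2 (volume : Measure ℝ) := by
  have h1 : MemLp f 2 (ENNReal.ofReal u⁻¹ • (volume : Measure ℝ)) :=
    (Lp.memLp f).smul_measure ENNReal.ofReal_ne_top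
  exact h1.comp_measurePreserving (mpDil u hu)

lemma norm_dil_toLp (u : ℝ) (hu : 0 < u) (f : L2) :
    ‖(memLp_dil u hu f).toLp _‖ = u ^ (-(1/2) : ℝ) * ‖f‖ := by
  rw [Lp.norm_toLp]
  have h := eLpNorm_comp_measurePreserving (p := 2) (g := (f : ℝ → ℂ))
    ((Lp.aestronglyMeasurable f).smul_measure _) (mpDil u hu)
  change (eLpNorm ((f : ℝ → ℂ) ∘ fun x => u * x) 2 volume).toReal = _
  rw [h, eLpNorm_smul_measure_of_ne_top (by simp), smul_eq_mul, ENNReal.toReal_mul, ← Lp.norm_def,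
    ← ENNReal.toReal_rpow, ENNReal.toReal_ofReal (inv_pos.2 hu).le]
  congr 1
  rw [Real.inv_rpow hu.le, Real.rpow_neg hu.le]
  norm_num

/-- dilation operator -/
def dil (u : ℝ) (hu : 0 < u) : L2 →L[ℂ] L2 :=
  LinearMap.mkContinuous
    { toFun := fun f => (memLp_dil u hu f).toLp _
      map_add' := by
        intro f g
        rw [← MemLp.toLp_add]
        apply MemLp.toLp_congr
        exact (qmpDil u hu.ne').ae (Lp.coeFn_add f g)
      map_smul' := by
        intro c f
        rw [RingHom.id_apply, ← MemLp.toLp_const_smul]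
        apply MemLp.toLp_congr
        exact (qmpDil u hu.ne').ae (Lp.coeFn_smul c f) }
    (u ^ (-(1/2) : ℝ)) (fun f => (norm_dil_toLp u hu f).le)

lemma dil_coe (u : ℝ) (hu : 0 < u) (f : L2) :
    dil u hu f =ᵐ[volume] fun x => f (u * x) := MemLp.coeFn_toLp (memLp_dil u hu f)

lemma dil_norm (u : ℝ) (hu : 0 < u) (f : L2) : ‖dil u hu f‖ = u ^ (-(1/2) : ℝ) * ‖f‖ :=
  norm_dil_toLp u hu f

lemma dil_comp (u v : ℝ) (hu : 0 < u) (hv : 0 < v) (f : L2) :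
    dil u hu (dil v hv f) = dil (u * v) (mul_pos hu hv) f := by
  apply Lp.ext
  filter_upwards [dil_coe u hu (dil v hv f), dil_coe (u * v) (mul_pos hu hv) f,
    (qmpDil u hu.ne').ae (dil_coe v hv f)] with x h1 h2 h3
  rw [h1, h2, h3]
  congr 1
  ring

/-- the coefficient function -/
def phi (f g : L2) (u : ℝ) : ℂ := ∫ x : ℝ, f (u * x) * (starRingEnd ℂ) (g x)

lemma phi_eq (f g : L2) (u : ℝ) (hu : 0 < u) : phi f g u = inner ℂ g (dil u hu f) := by
  rw [L2.inner_def]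
  apply integral_congr_ae
  filter_upwards [dil_coe u hu f] with x h
  rw [h]; rfl

lemma phi_bound (f g : L2) (u : ℝ) (hu : 0 < u) : ‖phi f g u‖ ≤ u ^ (-(1/2) : ℝ) * (‖f‖ * ‖g‖) := by
  rw [phi_eq f g u hu]
  refine (norm_inner_le_norm _ _).trans ?_
  rw [dil_norm]
  apply le_of_eq; ring

lemma phi_jointmeas (f g : L2) :
    StronglyMeasurable (Function.uncurry fun (u x : ℝ) => (f (u * x) * (starRingEnd ℂ) (g x) : ℂ)) := by
  have hf := (Lp.stronglyMeasurable f).measurable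
  have hg := (Lp.stronglyMeasurable g).measurable
  apply Measurable.stronglyMeasurable
  unfold Function.uncurry
  have := Complex.continuous_conj.measurable
  exact (hf.comp (measurable_fst.mul measurable_snd)).mul (this.comp (hg.comp measurable_snd))

lemma phi_meas (f g : L2) : StronglyMeasurable (phi f g) :=
  (phi_jointmeas f g).integral_prod_right

lemma dil_inner (u : ℝ) (hu : 0 < u) (f g : L2) :
    inner ℂ g (dil u hu f) = (u⁻¹ : ℂ) * inner ℂ (dil u⁻¹ (inv_pos.2 hu) g) f := by
  rw [← phi_eq, L2.inner_def]
  have h : ∫ x, inner ℂ (dil u⁻¹ (inv_pos.2 hu) g x) (f x)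
      = ∫ x, f x * (starRingEnd ℂ) (g (u⁻¹ * x)) := by
    apply integral_congr_ae
    filter_upwards [dil_coe u⁻¹ (inv_pos.2 hu) g] with x h
    rw [h]; rfl
  rw [h]
  have := Measure.integral_comp_mul_left (fun x => f x * (starRingEnd ℂ) (g (u⁻¹ * x))) u
  have e : ∀ x, u⁻¹ * (u * x) = x := fun x => by field_simp
  simp only [e] at this
  rw [phi, this, abs_of_pos (inv_pos.2 hu)]
  simp

lemma phi_inv (f g : L2) (u : ℝ) (hu : 0 < u) :
    phi f g u = (u⁻¹ : ℂ) * (starRingEnd ℂ) (phi g f u⁻¹) := by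
  rw [phi_eq f g u hu, dil_inner, phi_eq g f _ (inv_pos.2 hu), inner_conj_symm]

lemma phi_integrableOn (f g : L2) : IntegrableOn (phi f g) (Set.Ioo 0 1) := by
  have h : IntegrableOn (fun u : ℝ => u ^ (-(1/2) : ℝ) * (‖f‖ * ‖g‖)) (Set.Ioo 0 1) := by
    apply Integrable.mul_const
    have := (intervalIntegral.intervalIntegrable_rpow' (a := 0) (b := 1) (r := -(1/2)) (by norm_num))
    rw [intervalIntegrable_iff_integrableOn_Ioo_of_le (by norm_num)] at this
    exact this
  refine Integrable.mono' h (phi_meas f g).aestronglyMeasurable ?_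
  filter_upwards [ae_restrict_mem measurableSet_Ioo] with u hu
  exact phi_bound f g u hu.1

/-- weak formulation -/
def IsW (k : ℝ → ℂ) (T : L2 →L[ℂ] L2) : Prop :=
  ∀ f g : L2, inner ℂ g (T f) = ∫ u in Set.Ioo (0:ℝ) 1, k u * phi f g u

lemma isW_of_hausdorff (K k : ℝ → ℂ) (hk : Measurable k)
    (hK : K = (Set.Ioo (0:ℝ) 1).indicator k)
    (hkint : IntegrableOn (fun u => ‖k u‖ * u ^ (-(1/2) : ℝ)) (Set.Ioo 0 1))
    (T : L2 →L[ℂ] L2) (hT : IsHausdorffOp K T) : IsW k T := by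
  intro f g
  rw [L2.inner_def]
  have h1 : ∫ x, inner ℂ (g x) (T f x) =
      ∫ x : ℝ, ∫ u in Set.Ioo (0:ℝ) 1, k u * (f (u * x) * (starRingEnd ℂ) (g x)) := by
    apply integral_congr_ae
    filter_upwards [hT f] with x hx
    rw [hx]
    change (∫ u, K u * f (u * x)) * (starRingEnd ℂ) (g x) = _
    rw [← integral_mul_const, ← integral_indicator measurableSet_Ioo]
    congr 1
    ext u
    by_cases h : u ∈ Set.Ioo (0:ℝ) 1
    · simp [hK, h, mul_assoc]
    · simp [hK, h]
  rw [h1, integral_integral_swap]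
  · apply integral_congr_ae
    filter_upwards with u
    rw [integral_const_mul]; rfl
  · rw [integrable_prod_iff']
    · constructor
      · filter_upwards [ae_restrict_mem measurableSet_Ioo] with u hu
        refine Integrable.const_mul (f := fun x => (f (u * x) * (starRingEnd ℂ) (g x) : ℂ)) ?_ (k u)
        exact MemLp.integrable_mul (p := 2) (q := 2) (memLp_dil u hu.1 f) (Lp.memLp g).star
      · refine Integrable.mono' (hkint.mul_const (‖f‖ * ‖g‖)) ?_ ?_
        · apply StronglyMeasurable.aestronglyMeasurable
          apply StronglyMeasurable.integral_prod_right (f := fun (u x : ℝ) =>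
            ‖k u * (f (u * x) * (starRingEnd ℂ) (g x))‖)
          apply StronglyMeasurable.norm
          exact ((hk.comp measurable_fst).mul (phi_jointmeas f g).measurable).stronglyMeasurable
        · filter_upwards [ae_restrict_mem measurableSet_Ioo] with u hu
          rw [Real.norm_of_nonneg (integral_nonneg fun _ => norm_nonneg _)]
          simp only [Function.uncurry, norm_mul]
          rw [integral_const_mul, mul_assoc]
          gcongr
          have h2 := integral_mul_le_Lp_mul_Lq_of_nonneg (μ := (volume : Measure ℝ)) (p := 2) (q := 2)
            (f := fun x => ‖f (u * x)‖) (g := fun x => ‖g x‖) (by constructor <;> norm_num)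
            (by filter_upwards with x using norm_nonneg _)
            (by filter_upwards with x using norm_nonneg _)
            (by simpa using (memLp_dil u hu.1 f).norm) (by simpa using (Lp.memLp g).norm)
          simp only [RCLike.norm_conj]
          refine h2.trans (le_of_eq ?_)
          have e1 : ∀ h : L2, (∫ x, ‖h x‖ ^ (2:ℝ)) ^ (1 / (2:ℝ)) = ‖h‖ := by
            intro h
            rw [← Real.sqrt_eq_rpow, @norm_eq_sqrt_re_inner ℂ, L2.inner_def]
            congr 1
            have : (∫ a, inner ℂ (h a) (h a)) = ((∫ x, ‖h x‖ ^ (2:ℝ) : ℝ) : ℂ) := by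
              rw [← integral_complex_ofReal]
              congr 1
              ext a
              rw [inner_self_eq_norm_sq_to_K]
              norm_num
            rw [this]; simp
          have e2 : ∫ x, ‖f (u * x)‖ ^ (2:ℝ) = ∫ x, ‖dil u hu.1 f x‖ ^ (2:ℝ) := by
            apply integral_congr_ae
            filter_upwards [dil_coe u hu.1 f] with x hx
            rw [hx]
          rw [e2, e1, e1, dil_norm]; ring
    · apply Measurable.aestronglyMeasurable
      exact (hk.comp measurable_snd).mul ((phi_jointmeas f g).measurable.comp measurable_swap)

/-- real Hölder kernel -/
def kr (t : ℝ) (u : ℝ) : ℝ := (Real.Gamma t)⁻¹ * (Real.log u⁻¹) ^ (t - 1)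

lemma kr_meas (t : ℝ) : Measurable (kr t) := by
  unfold kr; fun_prop

lemma holder_eq (t : ℝ) :
    holderKernel (t : ℂ) = (Set.Ioo (0:ℝ) 1).indicator (fun u => ((kr t u : ℝ) : ℂ)) := by
  ext u
  by_cases h : u ∈ Set.Ioo (0:ℝ) 1
  · have hl : 0 ≤ Real.log u⁻¹ := Real.log_nonneg ((one_le_inv₀ h.1).2 h.2.le)
    simp only [holderKernel, h, if_true, Set.indicator_of_mem, kr]
    rw [Complex.Gamma_ofReal]
    push_cast
    rw [Complex.ofReal_cpow hl]
    push_cast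
    rfl
  · simp only [holderKernel, h, if_false, Set.indicator_of_notMem, not_false_eq_true]

lemma gamma_int_real (t : ℝ) (ht : 0 < t) (r : ℝ) (hr : 0 < r) :
    IntegrableOn (fun y : ℝ => y ^ (t - 1) * Real.exp (-r * y)) (Set.Ioi 0) := by
  have := integrableOn_rpow_mul_exp_neg_mul_rpow (p := 1) (s := t - 1) (b := r) (by linarith) (by norm_num) hr
  simpa using this

lemma gamma_complex (t : ℝ) (ht : 0 < t) (w : ℂ) (hw : 0 < w.re) :
    ∫ y : ℝ in Set.Ioi 0, ((y ^ (t - 1) : ℝ) : ℂ) * Complex.exp (-(w * y))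
      = w⁻¹ ^ (t : ℂ) * Real.Gamma t := by
  set μ : Measure ℝ := (volume.restrict (Set.Ioi 0)).withDensity
    (fun y => ENNReal.ofReal (y ^ (t - 1))) with hμ
  have hmeas : Measurable (fun y : ℝ => Real.toNNReal (y ^ (t - 1))) := by fun_prop
  have hnn : ∀ y ∈ Set.Ioi (0:ℝ), ((Real.toNNReal (y ^ (t - 1)) : NNReal) : ℝ) = y ^ (t - 1) := by
    intro y hy
    exact Real.coe_toNNReal _ (Real.rpow_nonneg (le_of_lt hy) _)
  have hset : Set.Iio (0:ℝ) ⊆ ProbabilityTheory.integrableExpSet id μ := by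
    intro x hx
    change Integrable (fun y => Real.exp (x * id y)) μ
    rw [hμ]
    change Integrable _ ((volume.restrict (Set.Ioi 0)).withDensity
      (fun y => ((Real.toNNReal (y ^ (t - 1)) : NNReal) : ENNReal)))
    rw [integrable_withDensity_iff_integrable_smul hmeas]
    refine (gamma_int_real t ht (-x) (by simpa using hx)).congr ?_
    filter_upwards [ae_restrict_mem measurableSet_Ioi] with y hy
    rw [NNReal.smul_def, hnn y hy]
    simp
  have hm : ∀ z : ℂ, ProbabilityTheory.complexMGF id μ z =
      ∫ y : ℝ in Set.Ioi 0, ((y ^ (t - 1) : ℝ) : ℂ) * Complex.exp (z * y) := by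
    intro z
    unfold ProbabilityTheory.complexMGF
    rw [hμ]
    change ∫ y, _ ∂((volume.restrict (Set.Ioi 0)).withDensity
      (fun y => ((Real.toNNReal (y ^ (t - 1)) : NNReal) : ENNReal))) = _
    rw [integral_withDensity_eq_integral_smul hmeas]
    apply integral_congr_ae
    filter_upwards [ae_restrict_mem measurableSet_Ioi] with y hy
    rw [NNReal.smul_def, hnn y hy]
    simp
  have hopen : IsOpen {z : ℂ | z.re < 0} := isOpen_lt Complex.continuous_re continuous_const
  have han : AnalyticOnNhd ℂ (ProbabilityTheory.complexMGF id μ) {z : ℂ | z.re < 0} := by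
    apply ProbabilityTheory.analyticOnNhd_complexMGF.mono
    intro z hz
    exact interior_mono hset (by simpa using hz)
  have han2 : AnalyticOnNhd ℂ (fun z : ℂ => (-z)⁻¹ ^ (t : ℂ) * Real.Gamma t) {z : ℂ | z.re < 0} := by
    apply DifferentiableOn.analyticOnNhd _ hopen
    intro z hz
    apply DifferentiableAt.differentiableWithinAt
    have hz' : z.re < 0 := hz
    have hz0 : z ≠ 0 := by rintro rfl; simp at hz'
    have h1 : (-z)⁻¹ ∈ Complex.slitPlane := by
      left
      rw [Complex.inv_re]
      apply div_pos (by simpa using hz')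
      simpa [Complex.normSq_pos] using hz0
    have h2 : DifferentiableAt ℂ (fun z : ℂ => (-z)⁻¹) z :=
      (differentiableAt_id.neg).inv (by simpa using hz0)
    exact (h2.cpow_const h1).mul_const _
  have hpre : IsPreconnected {z : ℂ | z.re < 0} := (convex_halfSpace_re_lt 0).isPreconnected
  have heq : Set.EqOn (ProbabilityTheory.complexMGF id μ) (fun z : ℂ => (-z)⁻¹ ^ (t : ℂ) * Real.Gamma t)
      {z : ℂ | z.re < 0} := by
    apply han.eqOn_of_preconnected_of_frequently_eq han2 hpre (z₀ := -1) (by simp)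
    have htend : Tendsto (fun n : ℕ => (((-1 : ℝ) - 1 / ((n : ℝ) + 1) : ℝ) : ℂ)) atTop
        (nhdsWithin (-1) {(-1 : ℂ)}ᶜ) := by
      rw [tendsto_nhdsWithin_iff]
      constructor
      · have := (tendsto_const_nhds (x := (-1:ℝ))).sub (tendsto_one_div_add_atTop_nhds_zero_nat (𝕜 := ℝ))
        have h2 := (Complex.continuous_ofReal.tendsto _).comp this
        rw [sub_zero] at h2
        simpa [Function.comp_def] using h2
      · filter_upwards with n
        simp only [Set.mem_compl_iff, Set.mem_singleton_iff]
        intro h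
        have h' : (-1 : ℝ) - 1 / ((n : ℝ) + 1) = -1 := by exact_mod_cast h
        have : 0 < 1 / ((n : ℝ) + 1) := by positivity
        linarith
    refine htend.frequently (Frequently.of_forall fun n => ?_)
    set r : ℝ := 1 + 1 / ((n : ℝ) + 1) with hr
    have hrpos : 0 < r := by positivity
    have e : (-1 : ℝ) - 1 / ((n : ℝ) + 1) = -r := by rw [hr]; ring
    rw [e, hm]
    have := Complex.integral_cpow_mul_exp_neg_mul_Ioi (a := (t:ℂ)) (r := r) (by simpa using ht) hrpos
    rw [Complex.Gamma_ofReal, one_div] at this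
    simp only [Complex.ofReal_neg, neg_neg]
    rw [← this]
    apply setIntegral_congr_fun measurableSet_Ioi
    intro y hy
    simp only
    rw [Complex.ofReal_cpow (le_of_lt hy)]
    push_cast
    ring_nf
  have := heq (x := -w) (by simpa using hw)
  simp only [hm, neg_neg] at this
  rw [← this]
  simp only [neg_mul]

lemma image_exp : (fun y : ℝ => Real.exp (-y)) '' Set.Ioi 0 = Set.Ioo 0 1 := by
  ext u
  constructor
  · rintro ⟨y, hy, rfl⟩
    exact ⟨Real.exp_pos _, by simpa using hy⟩
  · rintro ⟨h0, h1⟩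
    exact ⟨-Real.log u, by simpa using Real.log_neg h0 h1, by simp [Real.exp_log h0]⟩

lemma deriv_exp' : ∀ y ∈ Set.Ioi (0:ℝ),
    HasDerivWithinAt (fun y : ℝ => Real.exp (-y)) (-Real.exp (-y)) (Set.Ioi 0) y := by
  intro y _
  have := ((hasDerivAt_id y).neg.exp).hasDerivWithinAt (s := Set.Ioi 0)
  simpa using this

lemma inj_exp' : Set.InjOn (fun y : ℝ => Real.exp (-y)) (Set.Ioi 0) := by
  intro a _ b _ h
  simpa using h

lemma kr_integrable (t : ℝ) (ht : 0 < t) :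
    IntegrableOn (fun u => ‖((kr t u : ℝ) : ℂ)‖ * u ^ (-(1/2) : ℝ)) (Set.Ioo 0 1) := by
  rw [← image_exp, integrableOn_image_iff_integrableOn_abs_deriv_smul measurableSet_Ioi
    deriv_exp' inj_exp']
  refine ((gamma_int_real t ht (1/2) (by norm_num)).const_mul (Real.Gamma t)⁻¹).congr ?_
  filter_upwards [ae_restrict_mem measurableSet_Ioi] with y hy
  have hy' : 0 < y := hy
  have hG := Real.Gamma_pos_of_pos ht
  have h0 : 0 ≤ y ^ (t - 1) := Real.rpow_nonneg hy'.le _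
  simp only [kr, Complex.norm_real, smul_eq_mul, abs_neg, Real.abs_exp]
  rw [← Real.exp_neg, neg_neg, Real.log_exp, ← Real.exp_mul, Real.norm_of_nonneg (by positivity)]
  have : Real.exp (-(1/2) * y) = Real.exp (-y) * Real.exp (-y * -(1/2)) := by
    rw [← Real.exp_add]; ring_nf
  rw [this]; ring

lemma kr_mellin (t : ℝ) (ht : 0 < t) (w : ℂ) (hw : 0 < w.re) :
    ∫ u in Set.Ioo (0:ℝ) 1, ((kr t u : ℝ) : ℂ) * (u : ℂ) ^ (w - 1) = w⁻¹ ^ (t : ℂ) := by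
  rw [← image_exp, integral_image_eq_integral_abs_deriv_smul measurableSet_Ioi
    deriv_exp' inj_exp']
  have hG := (Real.Gamma_pos_of_pos ht).ne'
  have h := gamma_complex t ht w hw
  have h2 : w⁻¹ ^ (t : ℂ) = ((Real.Gamma t)⁻¹ : ℝ) * (w⁻¹ ^ (t : ℂ) * Real.Gamma t) := by
    have hG' : (Real.Gamma t : ℂ) ≠ 0 := by exact_mod_cast hG
    rw [Complex.ofReal_inv, mul_comm, mul_assoc, mul_inv_cancel₀ hG', mul_one]
  rw [h2, ← h, ← integral_const_mul]
  apply setIntegral_congr_fun measurableSet_Ioi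
  intro y hy
  simp only [kr, abs_neg, Real.abs_exp]
  rw [← Real.exp_neg, neg_neg, Real.log_exp, Complex.real_smul]
  push_cast
  have h3 : Complex.exp (-(y:ℂ)) ^ (w - 1) = Complex.exp (-(y:ℂ) * (w - 1)) := by
    rw [Complex.cpow_def_of_ne_zero (Complex.exp_ne_zero _)]
    congr 2
    rw [show -(y:ℂ) = ((-y : ℝ) : ℂ) by simp, ← Complex.ofReal_exp, ← Complex.ofReal_log (Real.exp_pos _).le,
      Real.log_exp]
  rw [h3]
  have h4 : Complex.exp (-(w * y)) = Complex.exp (-(y:ℂ)) * Complex.exp (-(y:ℂ) * (w - 1)) := by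
    rw [← Complex.exp_add]; ring_nf
  rw [h4]; ring

section Cprops

variable (C : L2 →L[ℂ] L2)

lemma C_dil (hC : IsW (fun _ => 1) C) (u : ℝ) (hu : 0 < u) (f : L2) :
    C (dil u hu f) = dil u hu (C f) := by
  refine ext_inner_left ℂ fun g => ?_
  rw [hC, dil_inner, hC, ← integral_const_mul]
  apply setIntegral_congr_fun measurableSet_Ioo
  intro v hv
  simp only [one_mul]
  rw [phi_eq _ _ v hv.1, phi_eq _ _ v hv.1, ← dil_inner u hu, dil_comp, dil_comp]
  simp only [mul_comm]

lemma phi_C (hC : IsW (fun _ => 1) C) (u : ℝ) (hu : 0 < u) (f g : L2) :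
    phi (C f) g u = ∫ v in Set.Ioo (0:ℝ) 1, phi f g (u * v) := by
  rw [phi_eq _ _ u hu, ← C_dil C hC, hC]
  apply setIntegral_congr_fun measurableSet_Ioo
  intro v hv
  simp only [one_mul]
  rw [phi_eq _ _ v hv.1, phi_eq _ _ _ (mul_pos hu hv.1), dil_comp]
  simp only [mul_comm]

/-- the double integral -/
def JJ (f g : L2) : ℂ :=
  ∫ v in Set.Ioo (0:ℝ) 1, ∫ u in Set.Ioo (0:ℝ) 1, ((u⁻¹ : ℝ) : ℂ) * phi f g (v * u⁻¹)

lemma inner_CstarC (hC : IsW (fun _ => 1) C) (f g : L2) :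
    inner ℂ g ((star C * C) f) = JJ f g := by
  rw [ContinuousLinearMap.star_eq_adjoint, mul_apply_eq_comp, 
    ContinuousLinearMap.adjoint_inner_right, hC]
  unfold JJ
  apply setIntegral_congr_fun measurableSet_Ioo
  intro v hv
  simp only [one_mul]
  rw [phi_inv _ _ v hv.1, phi_C C hC _ (inv_pos.2 hv.1), ← integral_conj, ← integral_const_mul]
  apply setIntegral_congr_fun measurableSet_Ioo
  intro u hu
  have h0 : (0:ℝ) < v⁻¹ * u := mul_pos (inv_pos.2 hv.1) hu.1
  simp only
  rw [phi_inv g f (v⁻¹ * u) h0]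
  have hv0 : (v : ℂ) ≠ 0 := by exact_mod_cast hv.1.ne'
  have hu0 : (u : ℂ) ≠ 0 := by exact_mod_cast hu.1.ne'
  simp only [map_mul, Complex.conj_conj, mul_inv, inv_inv, Complex.ofReal_inv, map_inv₀, Complex.conj_ofReal,
    Complex.ofReal_mul]
  field_simp

lemma inner_CCstar (hC : IsW (fun _ => 1) C) (f g : L2) :
    inner ℂ g ((C * star C) f) = JJ f g := by
  rw [ContinuousLinearMap.star_eq_adjoint, mul_apply_eq_comp, hC]
  unfold JJ
  apply setIntegral_congr_fun measurableSet_Ioo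
  intro v hv
  simp only [one_mul]
  rw [phi_eq _ _ v hv.1, dil_inner, ContinuousLinearMap.adjoint_inner_right, C_dil C hC, ← inner_conj_symm,
    ← phi_eq, phi_C C hC _ (inv_pos.2 hv.1), ← integral_conj, ← integral_const_mul]
  apply setIntegral_congr_fun measurableSet_Ioo
  intro u hu
  have h0 : (0:ℝ) < v⁻¹ * u := mul_pos (inv_pos.2 hv.1) hu.1
  simp only
  rw [phi_inv g f (v⁻¹ * u) h0]
  have hv0 : (v : ℂ) ≠ 0 := by exact_mod_cast hv.1.ne'
  have hu0 : (u : ℂ) ≠ 0 := by exact_mod_cast hu.1.ne'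
  simp only [map_mul, Complex.conj_conj, mul_inv, inv_inv, Complex.ofReal_inv, map_inv₀, Complex.conj_ofReal,
    Complex.ofReal_mul]
  field_simp

lemma subst_inv (h : ℝ → ℂ) (v : ℝ) (hv : 0 < v) :
    ∫ u in Set.Ioo (0:ℝ) 1, ((u⁻¹ : ℝ) : ℂ) * h (v * u⁻¹) =
      ∫ s in Set.Ioi v, ((s⁻¹ : ℝ) : ℂ) * h s := by
  have him : (fun u : ℝ => v * u⁻¹) '' Set.Ioo 0 1 = Set.Ioi v := by
    ext s
    constructor
    · rintro ⟨u, hu, rfl⟩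
      have := (one_lt_inv₀ hu.1).2 hu.2
      simp only [Set.mem_Ioi]
      nlinarith
    · intro hs
      have hs' : v < s := hs
      have hs0 : 0 < s := hv.trans hs
      refine ⟨v / s, ⟨by positivity, (div_lt_one hs0).2 hs⟩, ?_⟩
      simp only
      field_simp
  rw [← him, integral_image_eq_integral_abs_deriv_smul (f' := fun u => v * -(u ^ 2)⁻¹) measurableSet_Ioo]
  · apply setIntegral_congr_fun measurableSet_Ioo
    intro u hu
    have hu1 := hu.1
    simp only
    rw [Complex.real_smul, ← mul_assoc, ← Complex.ofReal_mul]
    congr 2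
    rw [abs_mul, abs_neg, abs_of_pos hv, abs_of_pos (by positivity)]
    field_simp
  · intro u hu
    exact ((hasDerivAt_inv hu.1.ne').const_mul v).hasDerivWithinAt
  · intro a ha b hb hab
    have := mul_left_cancel₀ hv.ne' hab
    exact inv_injective this

lemma phi_integrable_Ioi (f g : L2) :
    IntegrableOn (fun s => ((s⁻¹ : ℝ) : ℂ) * phi f g s) (Set.Ioi 1) := by
  have h : IntegrableOn (fun u : ℝ => u ^ (-(3/2) : ℝ) * (‖f‖ * ‖g‖)) (Set.Ioi 1) := by
    apply Integrable.mul_const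
    exact integrableOn_Ioi_rpow_of_lt (by norm_num) (by norm_num)
  refine Integrable.mono' h ?_ ?_
  · exact ((by fun_prop : Measurable fun s : ℝ => ((s⁻¹ : ℝ) : ℂ)).mul
      (phi_meas f g).measurable).aestronglyMeasurable
  filter_upwards [ae_restrict_mem measurableSet_Ioi] with u hu
  have hu0 : (0:ℝ) < u := lt_trans one_pos hu
  rw [norm_mul, Complex.norm_real, Real.norm_of_nonneg (by positivity)]
  refine (mul_le_mul_of_nonneg_left (phi_bound f g u hu0) (by positivity)).trans (le_of_eq ?_)
  rw [← mul_assoc, ← Real.rpow_neg_one, ← Real.rpow_add hu0]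
  norm_num

lemma JJ_eq (hC : IsW (fun _ => 1) C) (f g : L2) :
    JJ f g = inner ℂ g ((C + star C) f) := by
  have hstar : inner ℂ g (star C f) = ∫ s in Set.Ioi (1:ℝ), ((s⁻¹ : ℝ) : ℂ) * phi f g s := by
    rw [← subst_inv _ 1 one_pos, ContinuousLinearMap.star_eq_adjoint,
      ContinuousLinearMap.adjoint_inner_right, ← inner_conj_symm, hC, ← integral_conj]
    apply setIntegral_congr_fun measurableSet_Ioo
    intro u hu
    simp only [one_mul]
    rw [phi_inv g f u hu.1]
    simp
  rw [add_apply, inner_add_right, hstar, hC]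
  unfold JJ
  have h1 : ∀ v ∈ Set.Ioo (0:ℝ) 1, ∫ u in Set.Ioo (0:ℝ) 1, ((u⁻¹ : ℝ) : ℂ) * phi f g (v * u⁻¹)
      = ∫ s in Set.Ioi (0:ℝ), (Set.Ioi v).indicator (fun s => ((s⁻¹ : ℝ) : ℂ) * phi f g s) s := by
    intro v hv
    rw [subst_inv _ v hv.1, setIntegral_indicator measurableSet_Ioi]
    congr 2
    rw [Set.Ioi_inter_Ioi, sup_of_le_right hv.1.le]
  rw [setIntegral_congr_fun measurableSet_Ioo h1]
  have hin : ∀ s ∈ Set.Ioi (0:ℝ), ∀ c : ℝ → ℂ, (fun v => (Set.Ioi v).indicator c s)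
      = (Set.Iio s).indicator (fun _ => c s) := by
    intro s hs c
    ext v
    by_cases h : v < s <;> simp [Set.indicator, h]
  have hval : ∀ s ∈ Set.Ioi (0:ℝ), ∀ E : Type, ∀ [NormedAddCommGroup E] [NormedSpace ℝ E] [CompleteSpace E], ∀ c : E,
      ∫ v in Set.Ioo (0:ℝ) 1, (Set.Iio s).indicator (fun _ => c) v = (min s 1) • c := by
    intro s hs E _ _ _ c
    have hs' : 0 < s := hs
    rw [setIntegral_indicator measurableSet_Iio, Set.Ioo_inter_Iio, setIntegral_const, min_comm]
    rw [Real.volume_real_Ioo_of_le (by positivity), sub_zero]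
  have hmm : Measurable (fun s => ((s⁻¹ : ℝ) : ℂ) * phi f g s) :=
    (by fun_prop : Measurable fun s : ℝ => ((s⁻¹ : ℝ) : ℂ)).mul (phi_meas f g).measurable
  have hA : IntegrableOn (fun s => (min s 1) • (((s⁻¹ : ℝ) : ℂ) * phi f g s)) (Set.Ioc 0 1) := by
    rw [integrableOn_Ioc_iff_integrableOn_Ioo]
    refine (phi_integrableOn f g).congr_fun ?_ measurableSet_Ioo
    intro s hs
    have : (s : ℂ) ≠ 0 := by exact_mod_cast hs.1.ne'
    simp only
    rw [min_eq_left hs.2.le, Complex.real_smul]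
    push_cast
    field_simp
  have hB : IntegrableOn (fun s => (min s 1) • (((s⁻¹ : ℝ) : ℂ) * phi f g s)) (Set.Ioi 1) := by
    refine (phi_integrable_Ioi f g).congr_fun ?_ measurableSet_Ioi
    intro s hs
    simp only
    rw [min_eq_right (le_of_lt hs), one_smul]
  have hAB : IntegrableOn (fun s => (min s 1) • (((s⁻¹ : ℝ) : ℂ) * phi f g s)) (Set.Ioi 0) := by
    rw [← Set.Ioc_union_Ioi_eq_Ioi (zero_le_one (α := ℝ))]
    exact hA.union hB
  rw [integral_integral_swap]
  · have h2 : ∀ s ∈ Set.Ioi (0:ℝ), ∫ v in Set.Ioo (0:ℝ) 1,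
        (Set.Ioi v).indicator (fun s => ((s⁻¹ : ℝ) : ℂ) * phi f g s) s
        = (min s 1) • (((s⁻¹ : ℝ) : ℂ) * phi f g s) := by
      intro s hs
      rw [hin s hs, hval s hs]
    rw [setIntegral_congr_fun measurableSet_Ioi h2, ← Set.Ioc_union_Ioi_eq_Ioi (zero_le_one (α := ℝ)),
      setIntegral_union (Set.Ioc_disjoint_Ioi le_rfl) measurableSet_Ioi hA hB, integral_Ioc_eq_integral_Ioo]
    congr 1
    · apply setIntegral_congr_fun measurableSet_Ioo
      intro s hs
      have : (s : ℂ) ≠ 0 := by exact_mod_cast hs.1.ne'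
      simp only
      rw [min_eq_left hs.2.le, Complex.real_smul]
      push_cast
      field_simp
    · apply setIntegral_congr_fun measurableSet_Ioi
      intro s hs
      simp only
      rw [min_eq_right (le_of_lt hs), one_smul]
  · rw [integrable_prod_iff']
    · constructor
      · filter_upwards [ae_restrict_mem measurableSet_Ioi] with s hs
        simp only [Function.uncurry]
        rw [hin s hs]
        exact (integrable_const _).indicator measurableSet_Iio
      · refine hAB.norm.congr ?_
        filter_upwards [ae_restrict_mem measurableSet_Ioi] with s hs
        have hs' : 0 < s := hs
        simp only [Function.uncurry]
        have : ∀ v, ‖(Set.Ioi v).indicator (fun s => ((s⁻¹ : ℝ) : ℂ) * phi f g s) s‖ =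
          (Set.Iio s).indicator (fun _ => ‖((s⁻¹ : ℝ) : ℂ) * phi f g s‖) v := by
          intro v
          by_cases h : v < s <;> simp [Set.indicator, h]
        simp only [this]
        rw [hval s hs, norm_smul, Real.norm_of_nonneg (by positivity), smul_eq_mul]
    · apply Measurable.aestronglyMeasurable
      have : Function.uncurry (fun x y => (Set.Ioi x).indicator (fun s => ((s⁻¹ : ℝ) : ℂ) * phi f g s) y) =
        ({p : ℝ × ℝ | p.1 < p.2}).indicator (fun p => ((p.2⁻¹ : ℝ) : ℂ) * phi f g p.2) := by
        ext p
        by_cases h : p.1 < p.2 <;> simp [Set.indicator, h, Function.uncurry]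
      rw [this]
      exact (hmm.comp measurable_snd).indicator (measurableSet_lt measurable_fst measurable_snd)

lemma C_rel1 (hC : IsW (fun _ => 1) C) : star C * C = C + star C := by
  ext1 f
  refine ext_inner_left ℂ fun g => ?_
  rw [inner_CstarC C hC, JJ_eq C hC]

lemma C_rel2 (hC : IsW (fun _ => 1) C) : C * star C = C + star C := by
  ext1 f
  refine ext_inner_left ℂ fun g => ?_
  rw [inner_CCstar C hC, JJ_eq C hC]

lemma C_normal (hC : IsW (fun _ => 1) C) : IsStarNormal C :=
  ⟨by rw [commute_iff_eq, C_rel1 C hC, C_rel2 C hC]⟩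

lemma C_spec_sub (hC : IsW (fun _ => 1) C) : spectrum ℂ C ⊆ Metric.sphere 1 1 := by
  have hU : C - 1 ∈ unitary (L2 →L[ℂ] L2) := by
    rw [Unitary.mem_iff]
    simp only [star_sub, star_one, sub_mul, mul_sub, mul_one, one_mul, C_rel1 C hC, C_rel2 C hC]
    constructor <;> abel
  have h := spectrum.subset_circle_of_unitary (𝕜 := ℂ) hU
  intro c hc
  have h2 : c - 1 ∈ spectrum ℂ (C - 1) := by
    have := (spectrum.sub_singleton_eq C (1:ℂ))
    rw [map_one] at this
    rw [← this]
    exact ⟨c, hc, 1, rfl, rfl⟩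
  have := h h2
  simpa [dist_eq_norm] using this

end Cprops

lemma key_fubini (φ : ℝ → ℂ) (hm : Measurable φ) (hφ : IntegrableOn φ (Set.Ioo 0 1)) (a : ℕ) :
    (a : ℂ) * ∫ u in Set.Ioo (0:ℝ) 1, ((u ^ a : ℝ) : ℂ) * ∫ v in Set.Ioo (0:ℝ) 1, φ (u * v)
      = ∫ s in Set.Ioo (0:ℝ) 1, ((1 - s ^ a : ℝ) : ℂ) * φ s := by
  rcases a with _ | n
  · simp
  have h1 : ∀ u ∈ Set.Ioo (0:ℝ) 1, ((u ^ (n+1) : ℝ) : ℂ) * ∫ v in Set.Ioo (0:ℝ) 1, φ (u * v)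
      = ∫ s in Set.Ioo (0:ℝ) 1, (Set.Iio u).indicator (fun s => ((u ^ n : ℝ) : ℂ) * φ s) s := by
    intro u hu
    rw [setIntegral_indicator measurableSet_Iio, Set.Ioo_inter_Iio, min_eq_right hu.2.le,
      integral_const_mul, ← integral_Ioc_eq_integral_Ioo, ← integral_Ioc_eq_integral_Ioo,
      ← intervalIntegral.integral_of_le zero_le_one, ← intervalIntegral.integral_of_le hu.1.le]
    have h := intervalIntegral.smul_integral_comp_mul_left (a := 0) (b := 1) φ u
    rw [mul_zero, mul_one, Complex.real_smul] at h
    rw [← h]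
    push_cast
    ring
  rw [setIntegral_congr_fun measurableSet_Ioo h1, integral_integral_swap, ← integral_const_mul]
  · apply setIntegral_congr_fun measurableSet_Ioo
    intro s hs
    simp only
    have h2 : ∀ u, (Set.Iio u).indicator (fun s => ((u ^ n : ℝ) : ℂ) * φ s) s
      = (Set.Ioi s).indicator (fun u => ((u ^ n : ℝ) : ℂ) * φ s) u := by
      intro u
      by_cases h : s < u <;> simp [Set.indicator, h]
    simp only [h2]
    rw [setIntegral_indicator measurableSet_Ioi, Set.Ioo_inter_Ioi, max_eq_right hs.1.le, integral_mul_const,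
      integral_complex_ofReal, ← integral_Ioc_eq_integral_Ioo, ← intervalIntegral.integral_of_le hs.2.le,
      integral_pow]
    have : ((n:ℂ) + 1) ≠ 0 := by exact_mod_cast Nat.succ_ne_zero n
    push_cast
    field_simp
    simp [mul_comm]
  · have hg : Integrable (fun p : ℝ × ℝ => (1 : ℂ) * φ p.2)
        ((volume.restrict (Set.Ioo (0:ℝ) 1)).prod (volume.restrict (Set.Ioo (0:ℝ) 1))) :=
      Integrable.mul_prod (integrable_const 1) hφ
    refine Integrable.mono hg ?_ ?_
    · apply Measurable.aestronglyMeasurable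
      have : Function.uncurry (fun u s => (Set.Iio u).indicator (fun s => ((u ^ n : ℝ) : ℂ) * φ s) s) =
        ({p : ℝ × ℝ | p.2 < p.1}).indicator (fun p => ((p.1 ^ n : ℝ) : ℂ) * φ p.2) := by
        ext p
        by_cases h : p.2 < p.1 <;> simp [Set.indicator, h, Function.uncurry]
      rw [this]
      refine Measurable.indicator ?_ (measurableSet_lt measurable_snd measurable_fst)
      exact (by fun_prop : Measurable fun p : ℝ × ℝ => ((p.1 ^ n : ℝ) : ℂ)).mul (hm.comp measurable_snd)
    · rw [Measure.prod_restrict]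
      filter_upwards [ae_restrict_mem (measurableSet_Ioo.prod measurableSet_Ioo)] with p hp
      have hp1 := hp.1
      simp only [Function.uncurry]
      refine (norm_indicator_le_norm_self _ _).trans ?_
      rw [norm_mul, norm_mul]
      gcongr
      rw [Complex.norm_real, norm_one, norm_pow, Real.norm_of_nonneg hp1.1.le]
      exact pow_le_one₀ hp1.1.le hp1.2.le

lemma phi_add_smul (h k g : L2) (a : ℂ) (u : ℝ) (hu : 0 < u) :
    phi (h + a • k) g u = phi h g u + a * phi k g u := by
  simp only [phi_eq _ _ u hu, map_add, map_smul, inner_add_right, inner_smul_right]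

lemma pow_phi_integrable (f g : L2) (a : ℕ) :
    IntegrableOn (fun u => ((u ^ a : ℝ) : ℂ) * phi f g u) (Set.Ioo 0 1) := by
  refine Integrable.mono (phi_integrableOn f g) ?_ ?_
  · exact ((by fun_prop : Measurable fun u : ℝ => ((u ^ a : ℝ) : ℂ)).mul
      (phi_meas f g).measurable).aestronglyMeasurable
  · filter_upwards [ae_restrict_mem measurableSet_Ioo] with u hu
    rw [norm_mul, Complex.norm_real, norm_pow, Real.norm_of_nonneg hu.1.le]
    exact mul_le_of_le_one_left (norm_nonneg _) (pow_le_one₀ hu.1.le hu.2.le)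

lemma isW_S (C : L2 →L[ℂ] L2) (hC : IsW (fun _ => 1) C) (a : ℕ) (B : L2 →L[ℂ] L2)
    (hB : (1 + (a : ℂ) • C) * B = 1) : IsW (fun u => ((u ^ a : ℝ) : ℂ)) (C * B) := by
  intro f g
  set h := B f with hh
  have hf : f = h + (a : ℂ) • C h := by
    have := congrArg (fun T : L2 →L[ℂ] L2 => T f) hB
    simpa using this.symm
  rw [mul_apply_eq_comp, ← hh, hC]
  have e1 : ∀ u ∈ Set.Ioo (0:ℝ) 1, ((u ^ a : ℝ) : ℂ) * phi f g u =
      ((u ^ a : ℝ) : ℂ) * phi h g u + (a:ℂ) * (((u ^ a : ℝ) : ℂ) * phi (C h) g u) := by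
    intro u hu
    have : phi f g u = phi (h + (a : ℂ) • C h) g u := by rw [← hf]
    rw [this, phi_add_smul _ _ _ _ _ hu.1]
    ring
  rw [setIntegral_congr_fun measurableSet_Ioo e1, integral_add (pow_phi_integrable h g a)
    ((pow_phi_integrable (C h) g a).const_mul _)]
  rw [integral_const_mul (a : ℂ), integral_const_mul (1 : ℂ)]
  have e2 : ∀ u ∈ Set.Ioo (0:ℝ) 1, ((u ^ a : ℝ) : ℂ) * phi (C h) g u =
      ((u ^ a : ℝ) : ℂ) * ∫ v in Set.Ioo (0:ℝ) 1, phi h g (u * v) := by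
    intro u hu
    rw [phi_C C hC u hu.1]
  rw [setIntegral_congr_fun measurableSet_Ioo e2, key_fubini _ (phi_meas h g).measurable
    (phi_integrableOn h g)]
  have e3 : ∀ u ∈ Set.Ioo (0:ℝ) 1, ((1 - u ^ a : ℝ) : ℂ) * phi h g u =
      phi h g u - ((u ^ a : ℝ) : ℂ) * phi h g u := by
    intro u hu
    push_cast; ring
  rw [setIntegral_congr_fun measurableSet_Ioo e3, integral_sub (phi_integrableOn h g)
    (pow_phi_integrable h g a)]
  simp

lemma sphere_re {c : ℂ} (hc : c ∈ Metric.sphere (1:ℂ) 1) : c.re ^ 2 + c.im ^ 2 = 2 * c.re := by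
  have h : ‖c - 1‖ = 1 := by simpa [dist_eq_norm] using hc
  have h2 : Complex.normSq (c - 1) = 1 := by rw [Complex.normSq_eq_norm_sq, h]; norm_num
  rw [Complex.normSq_apply] at h2
  simp at h2
  nlinarith

lemma sphere_re_pos {c : ℂ} (hc : c ∈ Metric.sphere (1:ℂ) 1) (h0 : c ≠ 0) : 0 < c.re := by
  have h := sphere_re hc
  by_contra hn
  push Not at hn
  apply h0
  have h1 : c.re ^ 2 + c.im ^ 2 ≤ 0 := by linarith
  have h2 : c.re = 0 := by nlinarith [sq_nonneg c.re, sq_nonneg c.im]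
  have h3 : c.im = 0 := by nlinarith [sq_nonneg c.re, sq_nonneg c.im]
  exact Complex.ext h2 h3

lemma sphere_inv_re {c : ℂ} (hc : c ∈ Metric.sphere (1:ℂ) 1) (h0 : c ≠ 0) : (c⁻¹).re = 1/2 := by
  have h := sphere_re hc
  have h1 := sphere_re_pos hc h0
  rw [Complex.inv_re, Complex.normSq_apply, show c.re * c.re + c.im * c.im = 2 * c.re by nlinarith]
  field_simp

lemma sphere_ne {c : ℂ} (hc : c ∈ Metric.sphere (1:ℂ) 1) (a : ℕ) : 1 + (a:ℂ) * c ≠ 0 := by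
  intro h
  have h1 : 0 ≤ c.re := by
    by_cases h0 : c = 0
    · simp [h0]
    · exact (sphere_re_pos hc h0).le
  have h2 := congrArg Complex.re h
  simp at h2
  have : 0 ≤ (a:ℝ) * c.re := by positivity
  linarith

lemma mono_mellin (n : ℕ) (w : ℂ) (hw : 0 < w.re) :
    ∫ u in Set.Ioo (0:ℝ) 1, ((u ^ n : ℝ) : ℂ) * (u : ℂ) ^ (w - 1) = (w + n)⁻¹ := by
  have e : ∀ u ∈ Set.Ioo (0:ℝ) 1, ((u ^ n : ℝ) : ℂ) * (u : ℂ) ^ (w - 1) = (u:ℂ) ^ (w - 1 + n) := by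
    intro u hu
    have : (u:ℂ) ≠ 0 := by exact_mod_cast hu.1.ne'
    rw [Complex.cpow_add _ _ this, Complex.cpow_natCast]
    push_cast; ring
  rw [setIntegral_congr_fun measurableSet_Ioo e, ← integral_Ioc_eq_integral_Ioo,
    ← intervalIntegral.integral_of_le zero_le_one, integral_cpow]
  · have hne : w - 1 + n + 1 ≠ 0 := by
      intro h
      have := congrArg Complex.re h
      simp at this
      have h3 : (0:ℝ) ≤ n := by positivity
      linarith
    rw [Complex.ofReal_zero, Complex.zero_cpow hne, Complex.ofReal_one, Complex.one_cpow, sub_zero, one_div,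
      show w - 1 + n + 1 = w + n by ring]
  · left
    simp
    have h3 : (0:ℝ) ≤ n := by positivity
    linarith

lemma mono_mellin_int (n : ℕ) (w : ℂ) (hw : 0 < w.re) :
    IntegrableOn (fun u : ℝ => ((u ^ n : ℝ) : ℂ) * (u : ℂ) ^ (w - 1)) (Set.Ioo (0:ℝ) 1) := by
  by_contra h
  have h2 := integral_undef h
  rw [mono_mellin n w hw, inv_eq_zero] at h2
  have := congrArg Complex.re h2
  simp at this
  have h3 : (0:ℝ) ≤ n := by positivity
  linarith

lemma half_int : IntegrableOn (fun u : ℝ => u ^ (-(1/2) : ℝ)) (Set.Ioo 0 1) := by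
  have := (intervalIntegral.intervalIntegrable_rpow' (a := 0) (b := 1) (r := -(1/2)) (by norm_num))
  rwa [intervalIntegrable_iff_integrableOn_Ioo_of_le (by norm_num)] at this

lemma half_val : ∫ u in Set.Ioo (0:ℝ) 1, u ^ (-(1/2) : ℝ) = 2 := by
  rw [← integral_Ioc_eq_integral_Ioo, ← intervalIntegral.integral_of_le zero_le_one,
    integral_rpow (by left; norm_num)]
  norm_num

lemma poly_int (p : Polynomial ℝ) (k : ℝ → ℝ) (hk : Measurable k)
    (hkint : IntegrableOn (fun u => ‖((k u : ℝ) : ℂ)‖ * u ^ (-(1/2) : ℝ)) (Set.Ioo 0 1)) :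
    IntegrableOn (fun u => |k u - p.eval u| * u ^ (-(1/2) : ℝ)) (Set.Ioo 0 1) := by
  obtain ⟨M, hM⟩ := (isCompact_Icc (a := (0:ℝ)) (b := 1)).exists_bound_of_continuousOn p.continuous.continuousOn
  refine Integrable.mono' (hkint.add (half_int.const_mul M)) ?_ ?_
  · apply Measurable.aestronglyMeasurable
    have := p.continuous.measurable
    fun_prop
  · filter_upwards [ae_restrict_mem measurableSet_Ioo] with u hu
    have hu1 := hu.1
    have h0 : 0 ≤ u ^ (-(1/2) : ℝ) := by positivity
    rw [Real.norm_of_nonneg (by positivity)]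
    simp only [Pi.add_apply, Complex.norm_real]
    rw [← add_mul]
    gcongr
    refine (abs_sub _ _).trans ?_
    have := hM u ⟨hu.1.le, hu.2.le⟩
    rw [Real.norm_eq_abs] at *
    linarith

lemma poly_approx (k : ℝ → ℝ) (hk : Measurable k)
    (hkint : IntegrableOn (fun u => ‖((k u : ℝ) : ℂ)‖ * u ^ (-(1/2) : ℝ)) (Set.Ioo 0 1))
    (ε : ℝ) (hε : 0 < ε) :
    ∃ p : Polynomial ℝ, ∫ u in Set.Ioo (0:ℝ) 1, |k u - p.eval u| * u ^ (-(1/2) : ℝ) ≤ ε := by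
  have hmeas : Measurable (fun y : ℝ => Real.toNNReal (y ^ (-(1/2) : ℝ))) := by fun_prop
  have hnn : ∀ y ∈ Set.Ioo (0:ℝ) 1, ((Real.toNNReal (y ^ (-(1/2) : ℝ)) : NNReal) : ℝ) = y ^ (-(1/2) : ℝ) := by
    intro y hy
    exact Real.coe_toNNReal _ (Real.rpow_nonneg (le_of_lt hy.1) _)
  set μ : Measure ℝ := (volume.restrict (Set.Ioo (0:ℝ) 1)).withDensity
    (fun y => ((Real.toNNReal (y ^ (-(1/2) : ℝ)) : NNReal) : ENNReal)) with hμ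
  have hiff : ∀ h : ℝ → ℝ, Integrable h μ ↔
      IntegrableOn (fun u => h u * u ^ (-(1/2) : ℝ)) (Set.Ioo 0 1) := by
    intro h
    rw [hμ, integrable_withDensity_iff_integrable_smul hmeas]
    apply integrable_congr
    filter_upwards [ae_restrict_mem measurableSet_Ioo] with y hy
    rw [NNReal.smul_def, hnn y hy, smul_eq_mul, mul_comm]
  have hval : ∀ h : ℝ → ℝ, ∫ x, h x ∂μ = ∫ u in Set.Ioo (0:ℝ) 1, h u * u ^ (-(1/2) : ℝ) := by
    intro h
    rw [hμ, integral_withDensity_eq_integral_smul hmeas]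
    apply integral_congr_ae
    filter_upwards [ae_restrict_mem measurableSet_Ioo] with y hy
    rw [NNReal.smul_def, hnn y hy, smul_eq_mul, mul_comm]
  have hfin : IsFiniteMeasure μ := by
    have := (hiff (fun _ => 1)).2 (by simpa using half_int)
    rw [integrable_const_iff] at this
    simpa using this
  have hki : Integrable k μ := by
    rw [← integrable_norm_iff hk.aestronglyMeasurable, hiff]
    simpa using hkint
  obtain ⟨g, hg, hgi⟩ := hki.exists_boundedContinuous_integral_sub_le (half_pos hε)
  obtain ⟨p, hp⟩ := exists_polynomial_near_of_continuousOn 0 1 g g.continuous.continuousOn (ε/4) (by positivity)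
  refine ⟨p, ?_⟩
  rw [hval] at hg
  have hgi2 : IntegrableOn (fun u => ‖k u - g u‖ * u ^ (-(1/2) : ℝ)) (Set.Ioo 0 1) :=
    (hiff _).1 (hki.sub hgi).norm
  calc ∫ u in Set.Ioo (0:ℝ) 1, |k u - p.eval u| * u ^ (-(1/2) : ℝ)
      ≤ ∫ u in Set.Ioo (0:ℝ) 1, (‖k u - g u‖ * u ^ (-(1/2) : ℝ) + (ε/4) * u ^ (-(1/2) : ℝ)) := by
        apply setIntegral_mono_on (poly_int p k hk hkint) _ measurableSet_Ioo
        · intro u hu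
          have hu1 := hu.1
          have h0 : 0 ≤ u ^ (-(1/2) : ℝ) := by positivity
          rw [← add_mul]
          gcongr
          have h1 := hp u ⟨hu.1.le, hu.2.le⟩
          rw [Real.norm_eq_abs]
          have h2 : |k u - p.eval u| ≤ |k u - g u| + |g u - p.eval u| := abs_sub_le _ _ _
          rw [abs_sub_comm (g u)] at h2
          linarith
        · exact hgi2.add (half_int.const_mul _)
    _ ≤ ε := by
        rw [integral_add hgi2 (half_int.const_mul _), integral_const_mul, half_val]
        linarith

section HC
variable (C : L2 →L[ℂ] L2)

/-- `(1 + aC)⁻¹` -/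
def BB (a : ℕ) : L2 →L[ℂ] L2 := cfc (fun c : ℂ => (1 + (a:ℂ) * c)⁻¹) C

lemma BB_cont (hC : IsW (fun _ => 1) C) (a : ℕ) :
    ContinuousOn (fun c : ℂ => (1 + (a:ℂ) * c)⁻¹) (spectrum ℂ C) := by
  apply ContinuousOn.inv₀ (by fun_prop)
  intro c hc
  exact sphere_ne (C_spec_sub C hC hc) a

lemma CB_eq (hC : IsW (fun _ => 1) C) (a : ℕ) :
    C * BB C a = cfc (fun c : ℂ => c * (1 + (a:ℂ) * c)⁻¹) C := by
  have hN := C_normal C hC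
  rw [cfc_mul (fun c : ℂ => c) _ C (by fun_prop) (BB_cont C hC a), cfc_id' ℂ C]
  rfl

lemma BB_inv (hC : IsW (fun _ => 1) C) (a : ℕ) : (1 + (a : ℂ) • C) * BB C a = 1 := by
  have hN := C_normal C hC
  have h1 : (1 + (a : ℂ) • C) = cfc (fun c : ℂ => 1 + (a:ℂ) * c) C := by
    rw [cfc_const_add (1:ℂ) (fun c : ℂ => (a:ℂ) * c) C (by fun_prop), cfc_const_mul_id (a:ℂ) C, map_one]
  rw [h1, BB, ← cfc_mul _ _ C (by fun_prop) (BB_cont C hC a), ← cfc_one (R := ℂ) C]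
  apply cfc_congr
  intro c hc
  exact mul_inv_cancel₀ (sphere_ne (C_spec_sub C hC hc) a)

/-- polynomial in the approximants -/
def TP (p : Polynomial ℝ) : L2 →L[ℂ] L2 := ∑ n ∈ p.support, (p.coeff n : ℂ) • (C * BB C n)

/-- its symbol -/
def FP (p : Polynomial ℝ) (c : ℂ) : ℂ := ∑ n ∈ p.support, (p.coeff n : ℂ) * (c * (1 + (n:ℂ) * c)⁻¹)

lemma FP_cont (hC : IsW (fun _ => 1) C) (p : Polynomial ℝ) : ContinuousOn (FP p) (spectrum ℂ C) := by
  unfold FP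
  apply continuousOn_finset_sum
  intro n _
  exact continuousOn_const.mul (continuousOn_id.mul (BB_cont C hC n))

lemma TP_eq (hC : IsW (fun _ => 1) C) (p : Polynomial ℝ) : TP C p = cfc (FP p) C := by
  have hN := C_normal C hC
  have hc : ∀ n : ℕ, ContinuousOn (fun c : ℂ => c * (1 + (n:ℂ) * c)⁻¹) (spectrum ℂ C) :=
    fun n => continuousOn_id.mul (BB_cont C hC n)
  have : FP p = ∑ n ∈ p.support, fun c : ℂ => (p.coeff n : ℂ) * (c * (1 + (n:ℂ) * c)⁻¹) := by
    ext c; simp [FP]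
  have hc2 : ∀ n ∈ p.support, ContinuousOn (fun c : ℂ => (p.coeff n : ℂ) * (c * (1 + (n:ℂ) * c)⁻¹))
      (spectrum ℂ C) := fun n _ => continuousOn_const.mul (hc n)
  rw [this, cfc_sum (fun (n : ℕ) (c : ℂ) => (p.coeff n : ℂ) * (c * (1 + (n:ℂ) * c)⁻¹)) C p.support hc2]
  unfold TP
  apply Finset.sum_congr rfl
  intro n _
  rw [cfc_const_mul _ _ C (hc n), CB_eq C hC]

lemma TP_range (p : Polynomial ℝ) : ∃ B : L2 →L[ℂ] L2, TP C p = C * B := by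
  refine ⟨∑ n ∈ p.support, (p.coeff n : ℂ) • BB C n, ?_⟩
  rw [Finset.mul_sum]
  unfold TP
  apply Finset.sum_congr rfl
  intro n _
  rw [mul_smul_comm]

lemma eval_sum (p : Polynomial ℝ) (u : ℝ) :
    ((p.eval u : ℝ) : ℂ) = ∑ n ∈ p.support, (p.coeff n : ℂ) * ((u ^ n : ℝ) : ℂ) := by
  rw [Polynomial.eval_eq_sum, Polynomial.sum]
  push_cast; rfl

lemma TP_isW (hC : IsW (fun _ => 1) C) (p : Polynomial ℝ) :
    IsW (fun u => ((p.eval u : ℝ) : ℂ)) (TP C p) := by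
  intro f g
  simp only [eval_sum, Finset.sum_mul, mul_assoc]
  rw [integral_finset_sum _ (fun n _ => (pow_phi_integrable f g n).const_mul _)]
  simp only [TP, ContinuousLinearMap.sum_apply, inner_sum]
  apply Finset.sum_congr rfl
  intro n _
  rw [ContinuousLinearMap.smul_apply, inner_smul_right, isW_S C hC n _ (BB_inv C hC n) f g]
  rw [← integral_const_mul]

lemma FP_mellin (p : Polynomial ℝ) (c : ℂ) (hc : c ∈ Metric.sphere (1:ℂ) 1) (h0 : c ≠ 0) :
    IntegrableOn (fun u : ℝ => ((p.eval u : ℝ) : ℂ) * (u:ℂ) ^ (c⁻¹ - 1)) (Set.Ioo 0 1) ∧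
    ∫ u in Set.Ioo (0:ℝ) 1, ((p.eval u : ℝ) : ℂ) * (u:ℂ) ^ (c⁻¹ - 1) = FP p c := by
  have hw : 0 < (c⁻¹).re := by rw [sphere_inv_re hc h0]; norm_num
  have hi := fun n => mono_mellin_int n c⁻¹ hw
  simp only [eval_sum, Finset.sum_mul, mul_assoc]
  constructor
  · exact integrable_finset_sum _ (fun n _ => (hi n).const_mul _)
  · rw [integral_finset_sum _ (fun n _ => (hi n).const_mul _)]
    unfold FP
    apply Finset.sum_congr rfl
    intro n _
    rw [integral_const_mul, mono_mellin n _ hw]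
    congr 1
    have h3 := sphere_ne hc n
    have : c⁻¹ + n = c⁻¹ * (1 + n * c) := by
      rw [mul_add, mul_one, mul_comm (n:ℂ) c, ← mul_assoc, inv_mul_cancel₀ h0, one_mul]
    rw [this, mul_inv, inv_inv]

lemma bound_int (p : Polynomial ℝ) (t : ℝ) (ht : 0 < t) (ε M : ℝ) (hM : 0 ≤ M)
    (hp : ∫ u in Set.Ioo (0:ℝ) 1, |kr t u - p.eval u| * u ^ (-(1/2) : ℝ) ≤ ε)
    (ψ : ℝ → ℂ) (hψ : ∀ u ∈ Set.Ioo (0:ℝ) 1, ‖ψ u‖ ≤ u ^ (-(1/2) : ℝ) * M) :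
    ‖∫ u in Set.Ioo (0:ℝ) 1, (((kr t u : ℝ) : ℂ) * ψ u - ((p.eval u : ℝ) : ℂ) * ψ u)‖ ≤ ε * M := by
  calc _ ≤ ∫ u in Set.Ioo (0:ℝ) 1, (|kr t u - p.eval u| * u ^ (-(1/2) : ℝ)) * M := by
        apply norm_integral_le_of_norm_le
        · exact (poly_int p (kr t) (kr_meas t) (kr_integrable t ht)).mul_const M
        · filter_upwards [ae_restrict_mem measurableSet_Ioo] with u hu
          rw [← sub_mul, norm_mul, ← Complex.ofReal_sub, Complex.norm_real, Real.norm_eq_abs, mul_assoc]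
          gcongr
          exact hψ u hu
    _ ≤ ε * M := by
        rw [integral_mul_const]
        gcongr

lemma kr_phi_int (t : ℝ) (ht : 0 < t) (ψ : ℝ → ℂ) (hm : Measurable ψ) (M : ℝ)
    (hψ : ∀ u ∈ Set.Ioo (0:ℝ) 1, ‖ψ u‖ ≤ u ^ (-(1/2) : ℝ) * M) :
    IntegrableOn (fun u => ((kr t u : ℝ) : ℂ) * ψ u) (Set.Ioo 0 1) := by
  refine Integrable.mono' ((kr_integrable t ht).mul_const M) ?_ ?_
  · have := kr_meas t
    apply Measurable.aestronglyMeasurable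
    fun_prop
  · filter_upwards [ae_restrict_mem measurableSet_Ioo] with u hu
    rw [norm_mul, mul_assoc]
    gcongr
    exact hψ u hu

lemma poly_phi_int (p : Polynomial ℝ) (f g : L2) :
    IntegrableOn (fun u => ((p.eval u : ℝ) : ℂ) * phi f g u) (Set.Ioo 0 1) := by
  simp only [eval_sum, Finset.sum_mul, mul_assoc]
  exact integrable_finset_sum _ (fun n _ => (pow_phi_integrable f g n).const_mul _)

lemma H_TP (hC : IsW (fun _ => 1) C) (t : ℝ) (ht : 0 < t) (H : L2 →L[ℂ] L2)
    (hH : IsW (fun u => ((kr t u : ℝ) : ℂ)) H) (p : Polynomial ℝ) (ε : ℝ) (hε : 0 ≤ ε)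
    (hp : ∫ u in Set.Ioo (0:ℝ) 1, |kr t u - p.eval u| * u ^ (-(1/2) : ℝ) ≤ ε) :
    ‖H - TP C p‖ ≤ ε := by
  apply ContinuousLinearMap.opNorm_le_bound _ hε
  intro f
  set y := (H - TP C p) f with hy
  have key : ‖inner ℂ y y‖ ≤ ε * (‖f‖ * ‖y‖) := by
    have e : inner ℂ y y = ∫ u in Set.Ioo (0:ℝ) 1, (((kr t u : ℝ) : ℂ) * phi f y u
        - ((p.eval u : ℝ) : ℂ) * phi f y u) := by
      conv_lhs => rw [hy]; arg 3; rw [← hy]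
      rw [← hy]
      have : inner ℂ y y = inner ℂ y (H f) - inner ℂ y (TP C p f) := by
        conv_lhs => arg 3; rw [hy]
        rw [sub_apply, inner_sub_right]
      rw [this, hH, TP_isW C hC p, integral_sub _ (poly_phi_int p f y)]
      exact kr_phi_int t ht _ (phi_meas f y).measurable _ (fun u hu => phi_bound f y u hu.1)
    rw [e]
    exact bound_int p t ht ε _ (by positivity) hp _ (fun u hu => phi_bound f y u hu.1)
  rw [inner_self_eq_norm_sq_to_K] at key
  have k2 : ‖y‖ * ‖y‖ ≤ (ε * ‖f‖) * ‖y‖ := by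
    have : ‖((‖y‖ : ℝ) : ℂ) ^ 2‖ = ‖y‖ * ‖y‖ := by
      rw [norm_pow, Complex.norm_real, norm_norm, sq]
    have h2 : ‖((‖y‖ : ℝ) : ℂ) ^ 2‖ ≤ ε * (‖f‖ * ‖y‖) := key
    rw [this] at h2
    linarith
  by_cases h0 : ‖y‖ = 0
  · rw [h0]; positivity
  · exact le_of_mul_le_mul_right k2 (lt_of_le_of_ne (norm_nonneg _) (Ne.symm h0))

lemma cpow_cont (hC : IsW (fun _ => 1) C) (t : ℝ) (ht : 0 < t) :
    ContinuousOn (fun c : ℂ => c ^ (t:ℂ)) (spectrum ℂ C) := by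
  intro c hc
  by_cases h0 : c = 0
  · subst h0
    apply ContinuousAt.continuousWithinAt
    exact (continuousAt_cpow_zero_of_re_pos (z := (t:ℂ)) (by simpa using ht)).comp
      (f := fun c : ℂ => (c, (t:ℂ))) (by fun_prop)
  · apply ContinuousAt.continuousWithinAt
    apply continuousAt_cpow_const
    left
    exact sphere_re_pos (C_spec_sub C hC hc) h0

lemma cfc_TP (hC : IsW (fun _ => 1) C) (t : ℝ) (ht : 0 < t) (p : Polynomial ℝ) (ε : ℝ) (hε : 0 ≤ ε)
    (hp : ∫ u in Set.Ioo (0:ℝ) 1, |kr t u - p.eval u| * u ^ (-(1/2) : ℝ) ≤ ε) :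
    ‖cfc (fun c : ℂ => c ^ (t:ℂ)) C - TP C p‖ ≤ ε := by
  have hN := C_normal C hC
  rw [TP_eq C hC, ← cfc_sub _ _ C (cpow_cont C hC t ht) (FP_cont C hC p)]
  apply norm_cfc_le hε
  intro c hc'
  have hc := C_spec_sub C hC hc'
  by_cases h0 : c = 0
  · subst h0
    have : (t:ℂ) ≠ 0 := by exact_mod_cast ht.ne'
    simp [FP, Complex.zero_cpow this, hε]
  have hw2 := sphere_inv_re hc h0
  have hw : 0 < (c⁻¹).re := by rw [hw2]; norm_num
  have hb : ∀ u ∈ Set.Ioo (0:ℝ) 1, ‖(u:ℂ) ^ (c⁻¹ - 1)‖ ≤ u ^ (-(1/2) : ℝ) * 1 := by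
    intro u hu
    rw [Complex.norm_cpow_eq_rpow_re_of_pos hu.1, mul_one, Complex.sub_re, hw2]
    norm_num
  have := bound_int p t ht ε 1 zero_le_one hp _ hb
  rw [integral_sub _ (FP_mellin p c hc h0).1, kr_mellin t ht _ hw, (FP_mellin p c hc h0).2, inv_inv, mul_one] at this
  · exact this
  · exact kr_phi_int t ht _ (by fun_prop) 1 hb

lemma H_eq_cfc (hC : IsW (fun _ => 1) C) (t : ℝ) (ht : 0 < t) (H : L2 →L[ℂ] L2)
    (hH : IsW (fun u => ((kr t u : ℝ) : ℂ)) H) : H = cfc (fun c : ℂ => c ^ (t:ℂ)) C := by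
  rw [← sub_eq_zero, ← norm_le_zero_iff]
  apply le_of_forall_pos_le_add
  intro ε hε
  obtain ⟨p, hp⟩ := poly_approx (kr t) (kr_meas t) (kr_integrable t ht) (ε/2) (by positivity)
  have h1 := H_TP C hC t ht H hH p _ (by positivity) hp
  have h2 := cfc_TP C hC t ht p _ (by positivity) hp
  have h3 := norm_sub_le_norm_sub_add_norm_sub H (TP C p) (cfc (fun c : ℂ => c ^ (t:ℂ)) C)
  rw [norm_sub_rev (TP C p)] at h3
  linarith

lemma H_perp (hC : IsW (fun _ => 1) C) (t : ℝ) (ht : 0 < t) (H : L2 →L[ℂ] L2)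
    (hH : IsW (fun u => ((kr t u : ℝ) : ℂ)) H) (x : L2) (hx : ∀ f, inner ℂ x (C f) = 0) (f : L2) :
    inner ℂ x (H f) = 0 := by
  rw [← norm_le_zero_iff]
  apply le_of_forall_pos_le_add
  intro ε hε
  set δ := ε / (‖x‖ * ‖f‖ + 1) with hδ
  have hδ0 : 0 < δ := by positivity
  obtain ⟨p, hp⟩ := poly_approx (kr t) (kr_meas t) (kr_integrable t ht) δ hδ0
  have h1 := H_TP C hC t ht H hH p _ hδ0.le hp
  obtain ⟨B, hB⟩ := TP_range C p
  have h2 : inner ℂ x (H f) = inner ℂ x ((H - TP C p) f) := by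
    rw [hB, sub_apply, inner_sub_right, mul_apply_eq_comp, hx, sub_zero]
  rw [h2, zero_add]
  calc _ ≤ ‖x‖ * ‖(H - TP C p) f‖ := norm_inner_le_norm _ _
    _ ≤ ‖x‖ * (δ * ‖f‖) := by gcongr; exact ContinuousLinearMap.le_of_opNorm_le _ h1 f
    _ = δ * (‖x‖ * ‖f‖) := by ring
    _ ≤ δ * (‖x‖ * ‖f‖ + 1) := by gcongr; linarith
    _ = ε := by rw [hδ]; field_simp
end HC

/-- test function -/
def Fz (z : ℂ) : ℝ → ℂ := (Set.Ioo (0:ℝ) 1).indicator (fun x : ℝ => (x:ℂ) ^ z)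

/-- tail function -/
def Gt : ℝ → ℂ := (Set.Ici (1:ℝ)).indicator (fun x : ℝ => ((x⁻¹ : ℝ) : ℂ))

lemma Fz_meas (z : ℂ) : Measurable (Fz z) :=
  Measurable.indicator (by fun_prop) measurableSet_Ioo

lemma Gt_meas : Measurable Gt :=
  Measurable.indicator (by fun_prop) measurableSet_Ici

lemma Fz_normsq (z : ℂ) : (fun x => ‖Fz z x‖ ^ 2) =
    (Set.Ioo (0:ℝ) 1).indicator (fun x : ℝ => x ^ (2 * z.re)) := by
  ext x
  by_cases h : x ∈ Set.Ioo (0:ℝ) 1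
  · simp only [Fz, Set.indicator_of_mem h]
    rw [Complex.norm_cpow_eq_rpow_re_of_pos h.1, mul_comm, Real.rpow_mul h.1.le, Real.rpow_two]
  · simp only [Fz, Set.indicator_of_notMem h]
    simp

lemma Fz_memLp (z : ℂ) (hz : -1 < 2 * z.re) : MemLp (Fz z) 2 (volume : Measure ℝ) := by
  rw [memLp_two_iff_integrable_sq_norm (Fz_meas z).aestronglyMeasurable, Fz_normsq,
    integrable_indicator_iff measurableSet_Ioo]
  have := (intervalIntegral.intervalIntegrable_rpow' (a := 0) (b := 1) hz)
  rwa [intervalIntegrable_iff_integrableOn_Ioo_of_le (by norm_num)] at this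

lemma Gt_memLp : MemLp Gt 2 (volume : Measure ℝ) := by
  rw [memLp_two_iff_integrable_sq_norm Gt_meas.aestronglyMeasurable]
  have : (fun x => ‖Gt x‖ ^ 2) = (Set.Ici (1:ℝ)).indicator (fun x : ℝ => x ^ (-2 : ℝ)) := by
    ext x
    by_cases h : x ∈ Set.Ici (1:ℝ)
    · simp only [Gt, Set.indicator_of_mem h]
      have h0 : 0 < x := lt_of_lt_of_le one_pos h
      rw [Complex.norm_real, Real.norm_eq_abs, sq_abs, inv_pow, Real.rpow_neg h0.le, Real.rpow_two]
    · simp only [Gt, Set.indicator_of_notMem h]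
      simp
  rw [this, integrable_indicator_iff measurableSet_Ici, integrableOn_Ici_iff_integrableOn_Ioi]
  exact integrableOn_Ioi_rpow_of_lt (by norm_num) (by norm_num)

lemma Fz_norm (z : ℂ) (hz : -1 < 2 * z.re) :
    ‖(Fz_memLp z hz).toLp _‖ ^ 2 = (2 * z.re + 1)⁻¹ := by
  have h := L2.inner_def (𝕜 := ℂ) ((Fz_memLp z hz).toLp _) ((Fz_memLp z hz).toLp _)
  rw [inner_self_eq_norm_sq_to_K] at h
  have h2 : ∫ x, inner ℂ ((Fz_memLp z hz).toLp _ x) ((Fz_memLp z hz).toLp _ x)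
      = ((∫ x, ‖Fz z x‖ ^ 2 : ℝ) : ℂ) := by
    rw [← integral_complex_ofReal]
    apply integral_congr_ae
    filter_upwards [(Fz_memLp z hz).coeFn_toLp] with x hx
    rw [hx, inner_self_eq_norm_sq_to_K]
    push_cast; rfl
  rw [h2, Fz_normsq, integral_indicator measurableSet_Ioo, ← integral_Ioc_eq_integral_Ioo,
    ← intervalIntegral.integral_of_le (by norm_num), integral_rpow (Or.inl hz)] at h
  have h3 : ((‖(Fz_memLp z hz).toLp _‖ ^ 2 : ℝ) : ℂ) = (((2 * z.re + 1)⁻¹ : ℝ) : ℂ) := by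
    push_cast
    refine h.trans ?_
    rw [Real.one_rpow, Real.zero_rpow (by linarith)]
    push_cast; ring
  exact_mod_cast h3

lemma cpow_int (z : ℂ) (hz : -1 < z.re) (m : ℝ) (hm : 0 < m) :
    ∫ u in Set.Ioo (0:ℝ) m, (u:ℂ) ^ z = (z + 1)⁻¹ * (m:ℂ) ^ (z + 1) := by
  rw [← integral_Ioc_eq_integral_Ioo, ← intervalIntegral.integral_of_le hm.le,
    integral_cpow (Or.inl hz)]
  have : z + 1 ≠ 0 := by
    intro h
    have := congrArg Complex.re h
    simp at this; linarith
  rw [Complex.ofReal_zero, Complex.zero_cpow this]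
  ring

lemma Fz_avg (z : ℂ) (hz : -1 < z.re) (x : ℝ) (hx : x ≠ 0) :
    ∫ u in Set.Ioo (0:ℝ) 1, Fz z (x * u) = (z + 1)⁻¹ * (Fz z x + Gt x) := by
  rcases lt_or_gt_of_ne hx with h | h
  · have h1 : Fz z x = 0 := Set.indicator_of_notMem (fun hh => by linarith [hh.1]) _
    have h2 : Gt x = 0 := Set.indicator_of_notMem (fun hh => by linarith [show (1:ℝ) ≤ x from hh]) _
    rw [h1, h2, setIntegral_congr_fun (g := fun _ => (0:ℂ)) measurableSet_Ioo]
    · simp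
    · intro u hu
      exact Set.indicator_of_notMem (fun hh => by nlinarith [hh.1, hu.1]) _
  · have key : ∀ m : ℝ, m ≤ 1 → (∀ u : ℝ, 0 < u → u < 1 → (x * u < 1 ↔ u < m)) →
        ∫ u in Set.Ioo (0:ℝ) 1, Fz z (x * u) = (x:ℂ)^z * ∫ u in Set.Ioo (0:ℝ) m, (u:ℂ) ^ z := by
      intro m hm1 hm
      rw [← integral_const_mul, ← integral_indicator measurableSet_Ioo,
        ← integral_indicator measurableSet_Ioo]
      congr 1
      ext u
      by_cases hu : u ∈ Set.Ioo (0:ℝ) 1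
      · rw [Set.indicator_of_mem hu]
        by_cases hum : u < m
        · have hxu : x * u ∈ Set.Ioo (0:ℝ) 1 := ⟨mul_pos h hu.1, (hm u hu.1 hu.2).2 hum⟩
          rw [Set.indicator_of_mem (show u ∈ Set.Ioo 0 m from ⟨hu.1, hum⟩), Fz,
            Set.indicator_of_mem hxu, Complex.ofReal_mul, Complex.mul_cpow_ofReal_nonneg h.le hu.1.le]
        · rw [Set.indicator_of_notMem (fun hh => hum hh.2), Fz,
            Set.indicator_of_notMem (fun hh => hum ((hm u hu.1 hu.2).1 hh.2))]
      · rw [Set.indicator_of_notMem hu, Set.indicator_of_notMem]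
        exact fun hh => hu ⟨hh.1, hh.2.trans_le hm1⟩
    by_cases h1 : x < 1
    · have e1 : Fz z x = (x:ℂ)^z := Set.indicator_of_mem (show x ∈ Set.Ioo (0:ℝ) 1 from ⟨h, h1⟩) _
      have e2 : Gt x = 0 := Set.indicator_of_notMem (fun hh => by linarith [show (1:ℝ) ≤ x from hh]) _
      rw [key 1 le_rfl (fun u h0 hu => ⟨fun _ => hu, fun _ => by nlinarith⟩), cpow_int z hz 1 one_pos, e1, e2]
      simp [mul_comm]
    · push Not at h1
      have e1 : Fz z x = 0 := Set.indicator_of_notMem (fun hh => by linarith [hh.2]) _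
      have e2 : Gt x = ((x⁻¹ : ℝ) : ℂ) := Set.indicator_of_mem (show x ∈ Set.Ici (1:ℝ) from h1) _
      rw [key x⁻¹ (inv_le_one_of_one_le₀ h1) (fun u h0 hu => by
        rw [← one_div, lt_div_iff₀ h, mul_comm]),
        cpow_int z hz _ (inv_pos.2 h), e1, e2]
      have hx0 : (x:ℂ) ≠ 0 := by exact_mod_cast hx
      have : (x:ℂ)^z * ((x⁻¹:ℝ):ℂ)^(z+1) = ((x⁻¹:ℝ):ℂ) := by
        have hi : ((x⁻¹:ℝ):ℂ) ≠ 0 := by exact_mod_cast inv_ne_zero hx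
        rw [Complex.cpow_add _ _ hi, Complex.cpow_one, ← mul_assoc,
          ← Complex.mul_cpow_ofReal_nonneg h.le (inv_pos.2 h).le, ← Complex.ofReal_mul,
          mul_inv_cancel₀ hx, Complex.ofReal_one, Complex.one_cpow, one_mul]
      rw [zero_add, mul_left_comm, this]

lemma holder_one : holderKernel 1 = (Set.Ioo (0:ℝ) 1).indicator (fun _ => (1:ℂ)) := by
  ext u
  by_cases h : u ∈ Set.Ioo (0:ℝ) 1
  · rw [Set.indicator_of_mem h]; simp [holderKernel, h.1, h.2]
  · rw [Set.indicator_of_notMem h]; simp only [holderKernel, h, if_false]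

lemma C_Fz (C : L2 →L[ℂ] L2) (hC : IsHausdorffOp (holderKernel 1) C) (z : ℂ) (hz : -1 < 2 * z.re) :
    C ((Fz_memLp z hz).toLp _) = (z + 1)⁻¹ • ((Fz_memLp z hz).toLp _ + Gt_memLp.toLp _) := by
  apply Lp.ext
  have hne : ∀ᵐ x : ℝ, x ≠ 0 := by
    have := (Set.countable_singleton (0:ℝ)).ae_notMem (volume : Measure ℝ)
    simpa using this
  filter_upwards [hC ((Fz_memLp z hz).toLp _), hne, (Fz_memLp z hz).coeFn_toLp, Gt_memLp.coeFn_toLp,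
    Lp.coeFn_smul ((z + 1)⁻¹) ((Fz_memLp z hz).toLp _ + Gt_memLp.toLp _),
    Lp.coeFn_add ((Fz_memLp z hz).toLp _) (Gt_memLp.toLp _)] with x h1 h2 h3 h4 h5 h6
  rw [h1, h5, Pi.smul_apply, h6, Pi.add_apply, h3, h4, smul_eq_mul, ← Fz_avg z (by linarith) x h2,
    ← integral_indicator measurableSet_Ioo]
  apply integral_congr_ae
  filter_upwards [(qmpDil x h2).ae (Fz_memLp z hz).coeFn_toLp] with u hu
  rw [mul_comm u x, hu, holder_one]
  by_cases h : u ∈ Set.Ioo (0:ℝ) 1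
  · rw [Set.indicator_of_mem h, Set.indicator_of_mem h, one_mul]
  · rw [Set.indicator_of_notMem h, Set.indicator_of_notMem h, zero_mul]

lemma spec_nonzero (C : L2 →L[ℂ] L2) (hC : IsHausdorffOp (holderKernel 1) C) (w : ℂ)
    (hw : w.re = 1/2) : w⁻¹ ∈ spectrum ℂ C := by
  intro hu
  obtain ⟨B, hB⟩ := hu.exists_left_inv
  have hw0 : w ≠ 0 := by intro h; rw [h] at hw; norm_num at hw
  set K := ‖B‖
  set Gn := ‖(Gt_memLp.toLp _ : L2)‖
  -- the estimate
  have est : ∀ ε : ℝ, 0 < ε → ∃ F : ℝ, 0 ≤ F ∧ F ^ 2 = (2 * ε)⁻¹ ∧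
      F ≤ K * (‖w⁻¹ - (w + ε)⁻¹‖ * F + ‖(w + (ε:ℂ))⁻¹‖ * Gn) := by
    intro ε hε
    set z : ℂ := w - 1 + ε with hzd
    have hz : -1 < 2 * z.re := by simp [hzd, hw]; linarith
    refine ⟨‖(Fz_memLp z hz).toLp _‖, norm_nonneg _, ?_, ?_⟩
    · rw [Fz_norm z hz]; congr 1; simp [hzd, hw]; ring
    · have h1 := C_Fz C hC z hz
      have hz1 : z + 1 = w + ε := by rw [hzd]; ring
      rw [hz1] at h1
      set F : L2 := (Fz_memLp z hz).toLp _
      set G : L2 := Gt_memLp.toLp _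
      have h2 : F = B ((w⁻¹ - (w + (ε:ℂ))⁻¹) • F - (w + (ε:ℂ))⁻¹ • G) := by
        have h3 : (algebraMap ℂ (L2 →L[ℂ] L2) w⁻¹ - C) F = (w⁻¹ - (w + (ε:ℂ))⁻¹) • F - (w + (ε:ℂ))⁻¹ • G := by
          rw [sub_apply, h1, Algebra.algebraMap_eq_smul_one, ContinuousLinearMap.smul_apply,
            ContinuousLinearMap.one_apply]
          module
        rw [← h3, ← mul_apply_eq_comp, hB, ContinuousLinearMap.one_apply]
      calc ‖F‖ = ‖B ((w⁻¹ - (w + (ε:ℂ))⁻¹) • F - (w + (ε:ℂ))⁻¹ • G)‖ := congrArg norm h2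
        _ ≤ K * ‖(w⁻¹ - (w + (ε:ℂ))⁻¹) • F - (w + (ε:ℂ))⁻¹ • G‖ := B.le_opNorm _
        _ ≤ _ := by
          gcongr
          refine (norm_sub_le _ _).trans ?_
          rw [norm_smul, norm_smul]
  have hcont : Tendsto (fun ε : ℝ => (w + (ε:ℂ))⁻¹) (nhdsWithin 0 (Set.Ioi 0)) (nhds w⁻¹) := by
    have : ContinuousAt (fun ε : ℝ => (w + (ε:ℂ))⁻¹) 0 := by
      apply ContinuousAt.inv₀ (by fun_prop); simpa using hw0
    have h2 := this.tendsto
    simp only [Complex.ofReal_zero, add_zero] at h2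
    exact h2.mono_left nhdsWithin_le_nhds
  have hA : Tendsto (fun ε : ℝ => K * ‖w⁻¹ - (w + (ε:ℂ))⁻¹‖) (nhdsWithin 0 (Set.Ioi 0)) (nhds 0) := by
    have := ((tendsto_const_nhds (x := w⁻¹)).sub hcont).norm.const_mul K
    simpa using this
  have hB2 : Tendsto (fun ε : ℝ => K * (‖(w + (ε:ℂ))⁻¹‖ * Gn)) (nhdsWithin 0 (Set.Ioi 0))
      (nhds (K * (‖w⁻¹‖ * Gn))) := (hcont.norm.mul_const Gn).const_mul K
  set L := K * (‖w⁻¹‖ * Gn) + 1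
  have hL : 0 < L := by positivity
  have e1 := hA.eventually (gt_mem_nhds (show (0:ℝ) < 1/2 by norm_num))
  have e2 := hB2.eventually (gt_mem_nhds (show K * (‖w⁻¹‖ * Gn) < L by simp [L]))
  have e3 : ∀ᶠ ε : ℝ in nhdsWithin 0 (Set.Ioi 0), ε < (8 * L ^ 2)⁻¹ :=
    nhdsWithin_le_nhds (gt_mem_nhds (by positivity))
  obtain ⟨ε, ⟨⟨h1, h2⟩, h3⟩, h4⟩ := (((e1.and e2).and e3).and self_mem_nhdsWithin).exists
  have h4' : 0 < ε := h4
  obtain ⟨F, hF0, hF2, hF⟩ := est ε h4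
  have hF3 : F < 2 * L := by nlinarith
  have h5 : (2 * ε)⁻¹ < 4 * L ^ 2 := by rw [← hF2]; nlinarith
  rw [inv_lt_comm₀ (by positivity) (by positivity)] at h5
  have : (8 * L ^ 2)⁻¹ = (4 * L ^ 2)⁻¹ / 2 := by field_simp; norm_num
  linarith

lemma spec_sphere (C : L2 →L[ℂ] L2) (hC : IsHausdorffOp (holderKernel 1) C) :
    Metric.sphere (1:ℂ) 1 ⊆ spectrum ℂ C := by
  intro c hc
  by_cases h0 : c = 0
  · subst h0
    have hcl := spectrum.isClosed (𝕜 := ℂ) C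
    have : Tendsto (fun n : ℕ => ((1/2 : ℂ) + n * I)⁻¹) atTop (nhds 0) := by
      rw [tendsto_zero_iff_norm_tendsto_zero]
      have h1 : Tendsto (fun n : ℕ => ((n:ℝ))⁻¹) atTop (nhds 0) := tendsto_inv_atTop_nhds_zero_nat
      apply squeeze_zero' (Eventually.of_forall fun n => norm_nonneg _) _ h1
      filter_upwards [eventually_gt_atTop 0] with n hn
      rw [norm_inv]
      have hn' : (0:ℝ) < n := by exact_mod_cast hn
      apply inv_anti₀ hn'
      have := Complex.abs_im_le_norm ((1/2 : ℂ) + n * I)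
      have h2 : ((1/2 : ℂ) + n * I).im = n := by simp
      rw [h2, abs_of_pos hn'] at this
      exact this
    exact hcl.mem_of_tendsto this (Eventually.of_forall fun n => spec_nonzero C hC _ (by simp))
  · have := spec_nonzero C hC c⁻¹ (by rw [sphere_inv_re hc h0])
    rwa [inv_inv] at this

lemma exp_b1 (w : ℂ) (hw : w.re ≤ Real.log 2) : ‖Complex.exp w - 1‖ ≤ 3 * ‖w‖ := by
  by_cases h : ‖w‖ ≤ 1
  · have := Complex.norm_exp_sub_one_le h
    linarith [norm_nonneg w]
  · have h1 : ‖Complex.exp w‖ ≤ 2 := by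
      rw [Complex.norm_exp, ← Real.exp_log (show (0:ℝ) < 2 by norm_num)]
      exact Real.exp_le_exp.2 hw
    have h2 := norm_sub_le (Complex.exp w) 1
    rw [norm_one] at h2
    linarith

lemma exp_b2 (w : ℂ) (hw : w.re ≤ Real.log 2) : ‖Complex.exp w - 1 - w‖ ≤ 4 * ‖w‖ ^ 2 := by
  by_cases h : ‖w‖ ≤ 1
  · have := Complex.norm_exp_sub_one_sub_id_le h
    nlinarith [sq_nonneg ‖w‖]
  · have h1 := exp_b1 w hw
    have h2 := norm_sub_le (Complex.exp w - 1) w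
    nlinarith

/-- symbol of the resolvent -/
def rr (lam c : ℂ) : ℂ := if c = 0 then 0 else (lam - Complex.log c)⁻¹

lemma sphere_norm_le {c : ℂ} (hc : c ∈ Metric.sphere (1:ℂ) 1) : ‖c‖ ≤ 2 := by
  have h : ‖c - 1‖ = 1 := by simpa [dist_eq_norm] using hc
  have := norm_le_norm_sub_add c 1
  rw [h, norm_one] at this
  linarith

lemma log_re_le {c : ℂ} (hc : c ∈ Metric.sphere (1:ℂ) 1) (h0 : c ≠ 0) :
    (Complex.log c).re ≤ Real.log 2 := by
  rw [Complex.log_re]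
  exact Real.log_le_log (norm_pos_iff.2 h0) (sphere_norm_le hc)

lemma den_ge (lam c : ℂ) : lam.re - Real.log ‖c‖ ≤ ‖lam - Complex.log c‖ := by
  have := Complex.re_le_norm (lam - Complex.log c)
  rwa [Complex.sub_re, Complex.log_re] at this

lemma den_delta (lam : ℂ) {c : ℂ} (hc : c ∈ Metric.sphere (1:ℂ) 1) (h0 : c ≠ 0) :
    lam.re - Real.log 2 ≤ ‖lam - Complex.log c‖ := by
  have h1 := den_ge lam c
  have h2 := log_re_le hc h0
  rw [Complex.log_re] at h2
  linarith

lemma rr_cont (lam : ℂ) (hlam : Real.log 2 < lam.re) :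
    ContinuousOn (rr lam) (Metric.sphere (1:ℂ) 1) := by
  intro c hc
  by_cases h0 : c = 0
  · subst h0
    rw [← continuousWithinAt_diff_self]
    unfold ContinuousWithinAt
    rw [show rr lam 0 = 0 by simp [rr], tendsto_zero_iff_norm_tendsto_zero]
    have h1 : Tendsto (fun c : ℂ => (lam.re - Real.log ‖c‖)⁻¹)
        (nhdsWithin 0 (Metric.sphere (1:ℂ) 1 \ {0})) (nhds 0) := by
      apply tendsto_inv_atTop_zero.comp
      have h2 : Tendsto (fun c : ℂ => Real.log ‖c‖) (nhdsWithin 0 {0}ᶜ) atBot :=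
        Real.tendsto_log_nhdsGT_zero.comp tendsto_norm_nhdsNE_zero
      have h3 := h2.mono_left (nhdsWithin_mono (0:ℂ)
        (show Metric.sphere (1:ℂ) 1 \ {0} ⊆ {0}ᶜ from fun x hx => hx.2))
      simpa [sub_eq_add_neg] using tendsto_atTop_add_const_left _ lam.re (tendsto_neg_atBot_atTop.comp h3)
    apply squeeze_zero' (Eventually.of_forall fun _ => norm_nonneg _) _ h1
    filter_upwards [self_mem_nhdsWithin] with c hc
    have hc0 : c ≠ 0 := hc.2
    rw [rr, if_neg hc0, norm_inv]
    have h2 := log_re_le hc.1 hc0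
    rw [Complex.log_re] at h2
    exact inv_anti₀ (by linarith) (den_ge lam c)
  · apply ContinuousAt.continuousWithinAt
    have hev : rr lam =ᶠ[nhds c] fun c => (lam - Complex.log c)⁻¹ := by
      filter_upwards [isOpen_ne.mem_nhds h0] with x hx
      rw [rr, if_neg hx]
    apply ContinuousAt.congr _ hev.symm
    apply ContinuousAt.inv₀
    · exact continuousAt_const.sub (continuousAt_clog (Or.inl (sphere_re_pos hc h0)))
    · rw [← norm_pos_iff]
      linarith [den_delta lam hc h0]

/-- symbol of the difference quotient error -/
def qq (lam : ℂ) (t : ℝ) (c : ℂ) : ℂ :=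
  (t:ℂ)⁻¹ * ((c ^ (t:ℂ) - 1) * rr lam c) - lam * rr lam c + 1

lemma qq_zero (lam : ℂ) (t : ℝ) : qq lam t 0 = 1 := by simp [qq, rr]

lemma qq_eq (lam : ℂ) (hlam : Real.log 2 < lam.re) (t : ℝ) (ht : 0 < t) {c : ℂ}
    (hc : c ∈ Metric.sphere (1:ℂ) 1) (h0 : c ≠ 0) :
    qq lam t c = (t:ℂ)⁻¹ * rr lam c * (Complex.exp (t * Complex.log c) - 1 - t * Complex.log c) := by
  have hd : lam - Complex.log c ≠ 0 := by
    rw [← norm_pos_iff]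
    linarith [den_delta lam hc h0]
  have ht' : (t:ℂ) ≠ 0 := by exact_mod_cast ht.ne'
  rw [qq, rr, if_neg h0, Complex.cpow_def_of_ne_zero h0, mul_comm (Complex.log c)]
  field_simp
  ring

lemma zr_le (lam : ℂ) (hlam : Real.log 2 < lam.re) {c : ℂ}
    (hc : c ∈ Metric.sphere (1:ℂ) 1) (h0 : c ≠ 0) :
    ‖Complex.log c‖ * ‖rr lam c‖ ≤ 1 + ‖lam‖ / (lam.re - Real.log 2) := by
  have hdd := den_delta lam hc h0
  have hd : lam - Complex.log c ≠ 0 := by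
    rw [← norm_pos_iff]
    linarith
  have e : Complex.log c * rr lam c = lam * (lam - Complex.log c)⁻¹ - 1 := by
    rw [rr, if_neg h0]; field_simp; ring
  rw [← norm_mul, e]
  refine (norm_sub_le _ _).trans ?_
  rw [norm_mul, norm_one, norm_inv, add_comm, div_eq_mul_inv]
  gcongr

lemma tlog_re {c : ℂ} (hc : c ∈ Metric.sphere (1:ℂ) 1) (h0 : c ≠ 0) (t : ℝ) (ht : 0 < t) (ht1 : t ≤ 1) :
    (t * Complex.log c).re ≤ Real.log 2 := by
  rw [Complex.re_ofReal_mul]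
  have := log_re_le hc h0
  have := Real.log_pos (show (1:ℝ) < 2 by norm_num)
  nlinarith

lemma qq_b1 (lam : ℂ) (hlam : Real.log 2 < lam.re) (t : ℝ) (ht : 0 < t) (ht1 : t ≤ 1) {c : ℂ}
    (hc : c ∈ Metric.sphere (1:ℂ) 1) :
    ‖qq lam t c‖ ≤ 4 * (1 + ‖lam‖ / (lam.re - Real.log 2)) := by
  by_cases h0 : c = 0
  · subst h0
    rw [qq_zero, norm_one]
    have : 0 ≤ ‖lam‖ / (lam.re - Real.log 2) := div_nonneg (norm_nonneg _) (by linarith)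
    linarith
  have hr := tlog_re hc h0 t ht ht1
  have h1 := exp_b1 _ hr
  have h2 := norm_sub_le (Complex.exp (t * Complex.log c) - 1) (t * Complex.log c)
  have hn : ‖(t:ℂ) * Complex.log c‖ = t * ‖Complex.log c‖ := by
    rw [norm_mul, Complex.norm_real, Real.norm_of_nonneg ht.le]
  have h3 := zr_le lam hlam hc h0
  rw [qq_eq lam hlam t ht hc h0, norm_mul, norm_mul, norm_inv, Complex.norm_real, Real.norm_of_nonneg ht.le]
  rw [hn] at h1 h2
  calc _ ≤ t⁻¹ * ‖rr lam c‖ * (4 * (t * ‖Complex.log c‖)) := by gcongr; linarith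
    _ = 4 * (‖Complex.log c‖ * ‖rr lam c‖) := by field_simp
    _ ≤ _ := by linarith

lemma clog_b {c : ℂ} (hc : c ∈ Metric.sphere (1:ℂ) 1) (h0 : c ≠ 0) :
    ‖Complex.log c‖ * ‖c‖ ≤ 10 := by
  have hp : 0 < ‖c‖ := norm_pos_iff.2 h0
  have h2 := sphere_norm_le hc
  have h1 : ‖Complex.log c‖ ≤ |Real.log ‖c‖| + |Complex.arg c| := by
    have := Complex.norm_le_abs_re_add_abs_im (Complex.log c)
    rwa [Complex.log_re, Complex.log_im] at this
  have h3 := Complex.abs_arg_le_pi c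
  have h4 := Real.pi_lt_four
  have h5 : |Real.log ‖c‖| * ‖c‖ ≤ 2 := by
    by_cases h : ‖c‖ ≤ 1
    · have := Real.abs_log_mul_self_lt _ hp h
      rw [abs_mul, abs_of_pos hp] at this
      linarith
    · push Not at h
      have h6 : Real.log ‖c‖ ≤ 1 := by linarith [Real.log_le_sub_one_of_pos hp]
      rw [abs_of_pos (Real.log_pos h)]
      nlinarith
  calc _ ≤ (|Real.log ‖c‖| + |Complex.arg c|) * ‖c‖ := by gcongr
    _ = |Real.log ‖c‖| * ‖c‖ + |Complex.arg c| * ‖c‖ := by ring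
    _ ≤ 2 + 4 * 2 := by gcongr; linarith
    _ = 10 := by norm_num

lemma qq_b2 (lam : ℂ) (hlam : Real.log 2 < lam.re) (t : ℝ) (ht : 0 < t) (ht1 : t ≤ 1) {c : ℂ}
    (hc : c ∈ Metric.sphere (1:ℂ) 1) :
    ‖qq lam t c * c‖ ≤ 40 * (1 + ‖lam‖ / (lam.re - Real.log 2)) * t := by
  have hnn : 0 ≤ ‖lam‖ / (lam.re - Real.log 2) := div_nonneg (norm_nonneg _) (by linarith)
  by_cases h0 : c = 0
  · subst h0
    rw [mul_zero, norm_zero]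
    positivity
  have hr := tlog_re hc h0 t ht ht1
  have h1 := exp_b2 _ hr
  have hn : ‖(t:ℂ) * Complex.log c‖ = t * ‖Complex.log c‖ := by
    rw [norm_mul, Complex.norm_real, Real.norm_of_nonneg ht.le]
  have h3 := zr_le lam hlam hc h0
  have h4 := clog_b hc h0
  rw [qq_eq lam hlam t ht hc h0, norm_mul, norm_mul, norm_mul, norm_inv, Complex.norm_real,
    Real.norm_of_nonneg ht.le]
  rw [hn] at h1
  calc _ ≤ t⁻¹ * ‖rr lam c‖ * (4 * (t * ‖Complex.log c‖) ^ 2) * ‖c‖ := by gcongr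
    _ = 4 * t * ((‖Complex.log c‖ * ‖rr lam c‖) * (‖Complex.log c‖ * ‖c‖)) := by field_simp
    _ ≤ 4 * t * ((1 + ‖lam‖ / (lam.re - Real.log 2)) * 10) := by gcongr
    _ = _ := by ring

lemma rr_image (lam : ℂ) : rr lam '' Metric.sphere (1:ℂ) 1 =
    {w : ℂ | ∃ s : ℝ, w = (lam + Complex.log (1/2 - (s : ℂ) * Complex.I))⁻¹} ∪ {0} := by
  have key : ∀ v : ℂ, v.re = 1/2 → v⁻¹ ≠ 0 ∧ rr lam v⁻¹ = (lam + Complex.log v)⁻¹ := by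
    intro v hv
    have hv0 : v ≠ 0 := by intro h; rw [h] at hv; norm_num at hv
    refine ⟨inv_ne_zero hv0, ?_⟩
    rw [rr, if_neg (inv_ne_zero hv0), Complex.log_inv, sub_neg_eq_add]
    intro h
    rw [Complex.arg_eq_pi_iff] at h
    linarith [h.1]
  ext w
  constructor
  · rintro ⟨c, hc, rfl⟩
    by_cases h0 : c = 0
    · right; subst h0; simp [rr]
    · left
      have hre := sphere_inv_re hc h0
      refine ⟨-(c⁻¹).im, ?_⟩
      have h1 := (key c⁻¹ (by rw [hre])).2
      rw [inv_inv] at h1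
      rw [h1]
      congr 3
      apply Complex.ext
      · rw [hre]; simp
      · simp
  · rintro (⟨s, rfl⟩ | h)
    · set v : ℂ := 1/2 - (s : ℂ) * Complex.I with hv
      have hre : v.re = 1/2 := by simp [hv]
      obtain ⟨h1, h2⟩ := key v hre
      refine ⟨v⁻¹, ?_, h2⟩
      have hv0 : v ≠ 0 := by intro h; rw [h] at hre; norm_num at hre
      rw [mem_sphere_iff_norm]
      have : v⁻¹ - 1 = (1 - v) / v := by field_simp
      rw [this, norm_div, div_eq_one_iff_eq (norm_ne_zero_iff.2 hv0)]
      have : 1 - v = (starRingEnd ℂ) v := by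
        apply Complex.ext
        · simp [hre]; norm_num
        · simp
      rw [this, Complex.norm_conj]
    · rw [Set.mem_singleton_iff] at h
      subst h
      exact ⟨0, by simp, by simp [rr]⟩

section fin
variable (C : L2 →L[ℂ] L2)

lemma QC_eq (hC : IsW (fun _ => 1) C) (lam : ℂ) (hlam : Real.log 2 < lam.re) (t : ℝ) (ht : 0 < t) :
    cfc (qq lam t) C = (t:ℂ)⁻¹ • ((cfc (fun c : ℂ => c ^ (t:ℂ)) C - 1) * cfc (rr lam) C)
      - lam • cfc (rr lam) C + 1 := by
  have hN := C_normal C hC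
  have hr := (rr_cont lam hlam).mono (C_spec_sub C hC)
  have hp := cpow_cont C hC t ht
  have hp1 : ContinuousOn (fun c : ℂ => c ^ (t:ℂ) - 1) (spectrum ℂ C) := hp.sub continuousOn_const
  have e1 : cfc (fun c : ℂ => c ^ (t:ℂ) - 1) C = cfc (fun c : ℂ => c ^ (t:ℂ)) C - 1 := by
    rw [cfc_sub _ (fun _ => (1:ℂ)) C hp continuousOn_const, cfc_const_one ℂ C]
  have hm : ContinuousOn (fun c : ℂ => (c ^ (t:ℂ) - 1) * rr lam c) (spectrum ℂ C) := hp1.mul hr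
  have hm2 : ContinuousOn (fun c : ℂ => (t:ℂ)⁻¹ * ((c ^ (t:ℂ) - 1) * rr lam c)) (spectrum ℂ C) :=
    continuousOn_const.mul hm
  have hl : ContinuousOn (fun c : ℂ => lam * rr lam c) (spectrum ℂ C) := continuousOn_const.mul hr
  unfold qq
  have hsub : ContinuousOn (fun c : ℂ => (t:ℂ)⁻¹ * ((c ^ (t:ℂ) - 1) * rr lam c) - lam * rr lam c)
    (spectrum ℂ C) := hm2.sub hl
  rw [cfc_add C _ (fun _ => (1:ℂ)) hsub continuousOn_const, cfc_const_one ℂ C,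
    cfc_sub _ _ C hm2 hl, cfc_const_mul _ _ C hm, cfc_const_mul _ _ C hr, cfc_mul _ _ C hp1 hr, e1]

lemma qq_cont (hC : IsW (fun _ => 1) C) (lam : ℂ) (hlam : Real.log 2 < lam.re) (t : ℝ) (ht : 0 < t) :
    ContinuousOn (qq lam t) (spectrum ℂ C) := by
  have hr := (rr_cont lam hlam).mono (C_spec_sub C hC)
  have hp := cpow_cont C hC t ht
  unfold qq
  exact ((continuousOn_const.mul ((hp.sub continuousOn_const).mul hr)).sub
    (continuousOn_const.mul hr)).add continuousOn_const

lemma Q_tendsto (hC : IsW (fun _ => 1) C) (hd : DenseRange C) (lam : ℂ) (hlam : Real.log 2 < lam.re)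
    (g : L2) : Tendsto (fun t : ℝ => cfc (qq lam t) C g) (nhdsWithin 0 (Set.Ioi 0)) (nhds 0) := by
  have hN := C_normal C hC
  set M := 1 + ‖lam‖ / (lam.re - Real.log 2) with hMd
  have hM : 0 < M := by
    have : 0 ≤ ‖lam‖ / (lam.re - Real.log 2) := div_nonneg (norm_nonneg _) (by linarith)
    positivity
  have b1 : ∀ t : ℝ, 0 < t → t ≤ 1 → ‖cfc (qq lam t) C‖ ≤ 4 * M := by
    intro t ht ht1
    apply norm_cfc_le (by positivity)
    intro c hc
    exact qq_b1 lam hlam t ht ht1 (C_spec_sub C hC hc)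
  have b2 : ∀ t : ℝ, 0 < t → t ≤ 1 → ‖cfc (qq lam t) C * C‖ ≤ 40 * M * t := by
    intro t ht ht1
    have : cfc (qq lam t) C * C = cfc (fun c => qq lam t c * c) C := by
      rw [cfc_mul _ (fun c : ℂ => c) C (qq_cont C hC lam hlam t ht) (by fun_prop), cfc_id' ℂ C]
    rw [this]
    apply norm_cfc_le (by positivity)
    intro c hc
    exact qq_b2 lam hlam t ht ht1 (C_spec_sub C hC hc)
  rw [Metric.tendsto_nhds]
  intro ε hε
  obtain ⟨f, hf⟩ := hd.exists_dist_lt g (show 0 < ε / (8 * M) by positivity)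
  rw [dist_eq_norm] at hf
  have hs : 0 < ε / (80 * M * (‖f‖ + 1)) := by positivity
  filter_upwards [Ioo_mem_nhdsGT (lt_min one_pos hs)] with t ht
  have ht1 : t ≤ 1 := (ht.2.trans_le (min_le_left _ _)).le
  have ht2 : t < ε / (80 * M * (‖f‖ + 1)) := ht.2.trans_le (min_le_right _ _)
  rw [dist_zero_right]
  have e : cfc (qq lam t) C g = cfc (qq lam t) C (g - C f) + (cfc (qq lam t) C * C) f := by
    rw [map_sub, mul_apply_eq_comp]; abel
  have n1 : ‖cfc (qq lam t) C (g - C f)‖ ≤ 4 * M * ‖g - C f‖ :=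
    ContinuousLinearMap.le_of_opNorm_le _ (b1 t ht.1 ht1) _
  have n2 : ‖(cfc (qq lam t) C * C) f‖ ≤ 40 * M * t * ‖f‖ :=
    ContinuousLinearMap.le_of_opNorm_le _ (b2 t ht.1 ht1) _
  have n3 : 4 * M * ‖g - C f‖ < ε / 2 := by
    rw [lt_div_iff₀ (by positivity)] at hf
    linarith
  have n4 : 40 * M * t * ‖f‖ ≤ ε / 2 := by
    rw [lt_div_iff₀ (by positivity)] at ht2
    have : 0 < M * t := mul_pos hM ht.1
    nlinarith [norm_nonneg f]
  rw [e]
  linarith [norm_add_le (cfc (qq lam t) C (g - C f)) ((cfc (qq lam t) C * C) f)]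

end fin

/-- For `Re λ > log 2`, the spectrum of the resolvent
`R(λ, log C)` of the generator `log C` of the Hölder semigroup on `L²(ℝ)` is
`{1/(λ + log(1/2 - i s)) : s ∈ ℝ} ∪ {0}` (principal branch of the logarithm). -/
theorem stmt12
    (H : ℂ → (L2 →L[ℂ] L2)) (hH0 : H 0 = 1)
    (hHdef : ∀ α : ℂ, 0 < α.re → IsHausdorffOp (holderKernel α) (H α))
    (A : L2 →ₗ.[ℂ] L2) (hA : IsGeneratorOf (fun t : ℝ => H (t : ℂ)) A)
    (lam : ℂ) (hlam : Real.log 2 < lam.re)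
    (R : L2 →L[ℂ] L2) (hR : IsResolventOf A lam R) :
    spectrum ℂ R =
      {w : ℂ | ∃ s : ℝ, w = (lam + Complex.log (1/2 - (s : ℂ) * Complex.I))⁻¹} ∪ {0} := by
  set C : L2 →L[ℂ] L2 := H 1 with hCd
  have hC1 : IsHausdorffOp (holderKernel 1) C := hHdef 1 (by simp)
  have hC : IsW (fun _ => 1) C := by
    refine isW_of_hausdorff _ (fun _ => 1) measurable_const holder_one ?_ C hC1
    have := (intervalIntegral.intervalIntegrable_rpow' (a := 0) (b := 1) (r := -(1/2)) (by norm_num))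
    rw [intervalIntegrable_iff_integrableOn_Ioo_of_le (by norm_num)] at this
    simpa using this
  have hN := C_normal C hC
  have hspec : spectrum ℂ C = Metric.sphere (1:ℂ) 1 :=
    Set.Subset.antisymm (C_spec_sub C hC) (spec_sphere C hC1)
  have hHt : ∀ t : ℝ, 0 < t → IsW (fun u => ((kr t u : ℝ) : ℂ)) (H t) := by
    intro t ht
    have hm := kr_meas t
    exact isW_of_hausdorff _ _ (by fun_prop) (holder_eq t) (kr_integrable t ht) _
      (hHdef t (by simpa using ht))
  -- dense range
  have hd : DenseRange C := by
    have h1 : (LinearMap.range (C : L2 →ₗ[ℂ] L2))ᗮ = ⊥ := by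
      rw [Submodule.eq_bot_iff]
      intro x hx
      have hx' : ∀ f, inner ℂ x (C f) = 0 := fun f =>
        (Submodule.mem_orthogonal' _ _).1 hx _ ⟨f, rfl⟩
      obtain ⟨hdom, heq⟩ := hR.1 x
      have ht1 := (hA (R x)).2 hdom
      have ht2 : Tendsto (fun t : ℝ => inner ℂ x ((t : ℂ)⁻¹ • (H (t:ℂ) (R x) - R x)))
          (nhdsWithin 0 (Set.Ioi 0)) (nhds (inner ℂ x (A ⟨R x, hdom⟩))) :=
        tendsto_const_nhds.inner ht1
      have ht0 : Tendsto (fun t : ℝ => (t:ℂ)) (nhdsWithin 0 (Set.Ioi 0)) (nhds 0) := by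
        have : Tendsto (fun t : ℝ => (t:ℂ)) (nhds 0) (nhds ((0:ℝ):ℂ)) :=
          Complex.continuous_ofReal.tendsto 0
        rw [Complex.ofReal_zero] at this
        exact this.mono_left nhdsWithin_le_nhds
      have ht3 := ht0.mul ht2
      rw [zero_mul] at ht3
      have hval : ∀ t : ℝ, 0 < t → inner ℂ x ((t : ℂ)⁻¹ • (H (t:ℂ) (R x) - R x))
          = -((t:ℂ)⁻¹ * inner ℂ x (R x)) := by
        intro t ht
        rw [inner_smul_right, inner_sub_right, H_perp C hC t ht (H t) (hHt t ht) x hx']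
        ring
      have hz : inner ℂ x (R x) = 0 := by
        have ht4 : Tendsto (fun _ : ℝ => -inner ℂ x (R x)) (nhdsWithin (0:ℝ) (Set.Ioi 0)) (nhds 0) := by
          refine ht3.congr' ?_
          filter_upwards [self_mem_nhdsWithin] with t ht
          have ht' : (0:ℝ) < t := ht
          have : (t:ℂ) ≠ 0 := by exact_mod_cast ht'.ne'
          rw [hval t ht]
          field_simp
        have := tendsto_nhds_unique ht4 tendsto_const_nhds
        rw [eq_comm, neg_eq_zero] at this
        exact this
      have hz2 : inner ℂ x (A ⟨R x, hdom⟩) = 0 := by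
        refine tendsto_nhds_unique ht2 (tendsto_const_nhds.congr' ?_)
        filter_upwards [self_mem_nhdsWithin] with t ht
        rw [hval t ht, hz]; simp
      have hxx : inner ℂ x x = (0:ℂ) := by
        conv_lhs => arg 3; rw [← heq]
        rw [inner_sub_right, inner_smul_right, hz, hz2]; simp
      exact inner_self_eq_zero.1 hxx
    have h2 := (Submodule.topologicalClosure_eq_top_iff).2 h1
    have h3 := Submodule.dense_iff_topologicalClosure_eq_top.2 h2
    exact h3
  -- identify the resolvent
  have hRR : R = cfc (rr lam) C := by
    ext1 g
    set h : L2 := cfc (rr lam) C g with hh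
    have hlim : Tendsto (fun t : ℝ => (t : ℂ)⁻¹ • (H (t:ℂ) h - h)) (nhdsWithin 0 (Set.Ioi 0))
        (nhds (lam • h - g)) := by
      have h1 := (Q_tendsto C hC hd lam hlam g).add_const (lam • h - g)
      rw [zero_add] at h1
      refine h1.congr' ?_
      filter_upwards [self_mem_nhdsWithin] with t ht
      rw [QC_eq C hC lam hlam t ht, ← H_eq_cfc C hC t ht (H t) (hHt t ht)]
      simp only [add_apply, sub_apply, smul_apply, mul_apply_eq_comp, one_apply_eq_self, ← hh]
      abel
    have hdom : h ∈ A.domain := (hA h).1.2 ⟨_, hlim⟩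
    have hAh : A ⟨h, hdom⟩ = lam • h - g := tendsto_nhds_unique ((hA h).2 hdom) hlim
    have := hR.2 h hdom
    rw [hAh, sub_sub_cancel] at this
    exact this
  rw [hRR, cfc_map_spectrum (rr lam) C hN (by rw [hspec]; exact rr_cont lam hlam), hspec, rr_image]
end
end

section
/- The spectrum of log 𝒞, the generator of the Hölder semigroup on L²(ℝ), coincides with its continuous spectrum and equals the curve σ(log 𝒞) = {log(2·cos y) + iy : y ∈ (−π/2, π/2)}. In particular, the spectral bound s(log 𝒞) := sup{Re(λ) : λ ∈ σ(log 𝒞)} equals log 2. -/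
open MeasureTheory Complex Filter

noncomputable section

/-- The spectrum of a partially defined operator: the complement of the set of
`z` admitting a bounded everywhere-defined resolvent `(z I - A)⁻¹`. -/
def pmapSpectrum (A : L2 →ₗ.[ℂ] L2) : Set ℂ :=
  {z : ℂ | ¬ ∃ R : L2 →L[ℂ] L2, IsResolventOf A z R}

/-- The continuous spectrum of a partially defined operator: spectral points `z`
for which `z I - A` is injective with dense range. -/
def pmapContinuousSpectrum (A : L2 →ₗ.[ℂ] L2) : Set ℂ :=
  {z ∈ pmapSpectrum A |
    (∀ f : A.domain, A f = z • (f : L2) → (f : L2) = 0) ∧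
    Dense (Set.range (fun f : A.domain => z • (f : L2) - A f))}

section generic



/-- Vector valued `L²`. -/
abbrev VL2 (E : Type) [NormedAddCommGroup E] : Type := Lp E 2 (volume : Measure ℝ)

variable {E : Type} [NormedAddCommGroup E] [NormedSpace ℂ E]

lemma lp_dct {ι : Type*} {l : Filter ι} [l.IsCountablyGenerated] (F : ι → VL2 E) (G : VL2 E)
    (D : ι → ℝ → E) (B : ℝ → ℝ) (hB : MemLp B 2 volume)
    (hD : ∀ᶠ i in l, (F i - G : VL2 E) =ᵐ[volume] D i)
    (hDB : ∀ᶠ i in l, ∀ᵐ x, ‖D i x‖ ≤ B x)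
    (hlim : ∀ᵐ x, Tendsto (fun i => D i x) l (nhds 0)) : Tendsto F l (nhds G) := by
  rw [Lp.tendsto_Lp_iff_tendsto_eLpNorm']
  have h2 : ∀ f : ℝ → E, eLpNorm f 2 volume = (∫⁻ x, ‖f x‖ₑ ^ (2:ℝ)) ^ (1/2:ℝ) := by
    intro f
    rw [eLpNorm_eq_lintegral_rpow_enorm_toReal (by norm_num) (by norm_num)]
    simp
  simp_rw [h2]
  have key : Tendsto (fun i => ∫⁻ x, ‖(F i - G : VL2 E) x‖ₑ ^ (2:ℝ)) l (nhds (∫⁻ x : ℝ, 0)) := by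
    classical
    have e : (fun i => ∫⁻ x, ‖(F i - G : VL2 E) x‖ₑ ^ (2:ℝ)) =ᶠ[l]
        fun i => ∫⁻ x, (if (∀ᵐ x, ‖D i x‖ ≤ B x) ∧ AEStronglyMeasurable (D i) volume then ‖D i x‖ₑ ^ (2:ℝ) else 0) := by
      filter_upwards [hD, hDB] with i hi hb
      have : AEStronglyMeasurable (D i) volume := (Lp.aestronglyMeasurable _).congr hi
      apply lintegral_congr_ae
      filter_upwards [hi] with x hx
      rw [hx, if_pos ⟨hb, this⟩]
    refine Tendsto.congr' e.symm ?_
    refine tendsto_of_seq_tendsto fun u hu => ?_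
    refine tendsto_lintegral_of_dominated_convergence' (fun x => ‖B x‖ₑ ^ (2:ℝ)) ?_ ?_ ?_ ?_
    · intro n
      by_cases h : (∀ᵐ x, ‖D (u n) x‖ ≤ B x) ∧ AEStronglyMeasurable (D (u n)) volume
      · simp only [h]; simpa using h.2.enorm.pow_const 2
      · simp only [h]; simp
    · intro n
      by_cases h : (∀ᵐ x, ‖D (u n) x‖ ≤ B x) ∧ AEStronglyMeasurable (D (u n)) volume
      · filter_upwards [h.1] with x hx
        rw [if_pos h]
        gcongr
        rw [enorm_le_iff_norm_le]
        exact hx.trans (le_abs_self _)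
      · simp only [if_neg h]; exact Eventually.of_forall fun x => bot_le
    · have := hB.eLpNorm_lt_top
      rw [eLpNorm_lt_top_iff_lintegral_rpow_enorm_lt_top (by norm_num) (by norm_num)] at this
      simpa using this.ne
    · filter_upwards [hlim] with x hx
      have h3 : Tendsto (fun i => ‖D i x‖ₑ ^ (2:ℝ)) l (nhds 0) := by
        have := (hx.enorm).ennrpow_const 2
        simpa using this
      refine tendsto_of_tendsto_of_tendsto_of_le_of_le tendsto_const_nhds (h3.comp hu) (fun i => by simp) ?_
      intro i
      dsimp
      split_ifs <;> simp
  have := key.ennrpow_const (1/2:ℝ)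
  simp only [lintegral_zero, ENNReal.zero_rpow_of_pos (show (0:ℝ) < 1/2 by norm_num)] at this
  refine this.congr fun i => ?_
  congr 1
  apply lintegral_congr_ae
  filter_upwards [Lp.coeFn_sub (F i) G] with x hx
  rw [hx]

lemma memLp_smul_bdd {m : ℝ → ℂ} (hm : Measurable m) {C : ℝ} (hC : ∀ x, ‖m x‖ ≤ C) {g : ℝ → E}
    (hg : MemLp g 2 volume) : MemLp (fun x => m x • g x) 2 volume := by
  refine MemLp.of_le_mul (c := C) hg (hm.aestronglyMeasurable.smul hg.1) ?_
  refine Eventually.of_forall fun x => ?_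
  rw [norm_smul]
  gcongr
  exact hC x

/-- multiplication by a bounded measurable function -/
def mulOp (E : Type) [NormedAddCommGroup E] [NormedSpace ℂ E] (m : ℝ → ℂ) (hm : Measurable m)
    (C : ℝ) (hC : ∀ x, ‖m x‖ ≤ C) : VL2 E →L[ℂ] VL2 E :=
  LinearMap.mkContinuous
    { toFun := fun g => (memLp_smul_bdd hm hC (Lp.memLp g)).toLp _
      map_add' := by
        intro f g
        apply Lp.ext
        filter_upwards [MemLp.coeFn_toLp (memLp_smul_bdd hm hC (Lp.memLp (f+g))),
          MemLp.coeFn_toLp (memLp_smul_bdd hm hC (Lp.memLp f)),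
          MemLp.coeFn_toLp (memLp_smul_bdd hm hC (Lp.memLp g)), Lp.coeFn_add f g,
          Lp.coeFn_add ((memLp_smul_bdd hm hC (Lp.memLp f)).toLp _)
            ((memLp_smul_bdd hm hC (Lp.memLp g)).toLp _)] with x h1 h2 h3 h4 h5
        rw [h1, h5, Pi.add_apply, h2, h3, h4, Pi.add_apply, smul_add]
      map_smul' := by
        intro c f
        apply Lp.ext
        filter_upwards [MemLp.coeFn_toLp (memLp_smul_bdd hm hC (Lp.memLp (c • f))),
          MemLp.coeFn_toLp (memLp_smul_bdd hm hC (Lp.memLp f)), Lp.coeFn_smul c f,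
          Lp.coeFn_smul c ((memLp_smul_bdd hm hC (Lp.memLp f)).toLp _)] with x h1 h2 h4 h5
        rw [h1, RingHom.id_apply, h5, Pi.smul_apply, h2, h4, Pi.smul_apply, smul_comm] }
    C (by
      intro f
      apply Lp.norm_le_mul_norm_of_ae_le_mul
      filter_upwards [MemLp.coeFn_toLp (memLp_smul_bdd hm hC (Lp.memLp f))] with x h1
      simp only [LinearMap.coe_mk, AddHom.coe_mk]
      rw [h1, norm_smul]
      gcongr
      exact hC x)

lemma mulOp_coe (m : ℝ → ℂ) (hm : Measurable m)
    (C : ℝ) (hC : ∀ x, ‖m x‖ ≤ C) (g : VL2 E) :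
    mulOp E m hm C hC g =ᵐ[volume] fun x => m x • g x :=
  MemLp.coeFn_toLp (memLp_smul_bdd hm hC (Lp.memLp g))

/-- The symbol. -/
def symb (x : ℝ) : ℂ := -Complex.log (1/2 + 2 * Real.pi * x * I)

lemma symb_arg_re (x : ℝ) : (1/2 + 2 * Real.pi * x * I : ℂ).re = 1/2 := by
  simp

lemma symb_arg_im (x : ℝ) : (1/2 + 2 * Real.pi * x * I : ℂ).im = 2 * Real.pi * x := by
  simp

lemma symb_arg_ne (x : ℝ) : (1/2 + 2 * Real.pi * x * I : ℂ) ≠ 0 := by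
  intro h
  have := symb_arg_re x
  rw [h] at this
  norm_num at this

lemma exp_neg_symb (x : ℝ) : Complex.exp (-symb x) = 1/2 + 2 * Real.pi * x * I := by
  rw [symb, neg_neg, Complex.exp_log (symb_arg_ne x)]

lemma symb_inj : Function.Injective symb := by
  intro x y h
  have h1 := exp_neg_symb x
  rw [h, exp_neg_symb y] at h1
  have := congrArg Complex.im h1
  rw [symb_arg_im, symb_arg_im] at this
  have hp := Real.pi_pos
  have : 2 * Real.pi * (y - x) = 0 := by linarith
  rcases mul_eq_zero.1 this with h | h
  · linarith
  · linarith

lemma symb_cont : Continuous symb := by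
  unfold symb
  refine Continuous.neg ?_
  refine Continuous.clog (by fun_prop) ?_
  intro x
  left
  rw [symb_arg_re]; norm_num

lemma symb_re_le (x : ℝ) : (symb x).re ≤ Real.log 2 := by
  rw [symb, Complex.neg_re, Complex.log_re]
  have h : (1/2:ℝ) ≤ ‖(1/2 + 2 * Real.pi * x * I : ℂ)‖ := by
    have := Complex.re_le_norm (1/2 + 2 * Real.pi * x * I : ℂ)
    rwa [symb_arg_re] at this
  have := Real.log_le_log (by norm_num) h
  rw [one_div, Real.log_inv] at this
  linarith

/-- the curve -/
def crv : Set ℂ := {z : ℂ | ∃ y ∈ Set.Ioo (-(Real.pi/2)) (Real.pi/2),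
      z = ((Real.log (2 * Real.cos y) : ℝ) : ℂ) + (y : ℂ) * Complex.I}

lemma range_symb : Set.range symb = crv := by
  have hp := Real.pi_pos
  ext z
  constructor
  · rintro ⟨x, rfl⟩
    have him : |(symb x).im| < Real.pi / 2 := by
      rw [symb, Complex.neg_im, Complex.log_im, abs_neg, Complex.abs_arg_lt_pi_div_two_iff]
      left; rw [symb_arg_re]; norm_num
    refine ⟨(symb x).im, ⟨(abs_lt.1 him).1, (abs_lt.1 him).2⟩, ?_⟩
    apply Complex.ext
    · simp only [add_re, ofReal_re, mul_re, I_re, mul_zero, ofReal_im, I_im, mul_one, sub_self, add_zero]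
      have h := congrArg Complex.re (exp_neg_symb x)
      rw [symb_arg_re, Complex.exp_re, neg_re, neg_im, Real.cos_neg, Real.exp_neg] at h
      have h2 : 2 * Real.cos (symb x).im = Real.exp (symb x).re := by
        field_simp at h; linarith
      rw [h2, Real.log_exp]
    · simp
  · rintro ⟨y, hy, rfl⟩
    have hc : 0 < Real.cos y := Real.cos_pos_of_mem_Ioo hy
    set z : ℂ := ((Real.log (2 * Real.cos y) : ℝ) : ℂ) + (y : ℂ) * Complex.I with hz
    have hre : z.re = Real.log (2 * Real.cos y) := by simp [hz]
    have him : z.im = y := by simp [hz]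
    refine ⟨(Complex.exp (-z)).im / (2 * Real.pi), ?_⟩
    have : (1/2 + 2 * Real.pi * ((Complex.exp (-z)).im / (2 * Real.pi) : ℝ) * I : ℂ) = Complex.exp (-z) := by
      apply Complex.ext
      · rw [symb_arg_re, Complex.exp_re, neg_re, neg_im, hre, him, Real.cos_neg, Real.exp_neg,
          Real.exp_log (by positivity)]
        field_simp
      · rw [symb_arg_im]; field_simp
    rw [symb, this, Complex.log_exp, neg_neg]
    · rw [neg_im, him]; linarith [hy.2]
    · rw [neg_im, him]; linarith [hy.1]

lemma crv_closed : IsClosed crv := by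
  have : crv = {z : ℂ | |z.im| ≤ Real.pi / 2 ∧ (Complex.exp (-z)).re = 1/2} := by
    ext z
    constructor
    · intro hz
      rw [← range_symb] at hz
      obtain ⟨x, rfl⟩ := hz
      constructor
      · rw [symb, Complex.neg_im, Complex.log_im, abs_neg]
        rw [Complex.abs_arg_le_pi_div_two_iff, symb_arg_re]; norm_num
      · rw [exp_neg_symb, symb_arg_re]
    · rintro ⟨h1, h2⟩
      rw [Complex.exp_re, neg_re, neg_im, Real.cos_neg, Real.exp_neg] at h2
      have hc : 2 * Real.cos z.im = Real.exp z.re := by field_simp at h2; linarith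
      have hc0 : 0 < Real.cos z.im := by have := Real.exp_pos z.re; linarith
      have hne : |z.im| ≠ Real.pi / 2 := by
        intro h
        rw [← Real.cos_abs, h, Real.cos_pi_div_two] at hc0
        exact lt_irrefl _ hc0
      have := abs_lt.1 (lt_of_le_of_ne h1 hne)
      refine ⟨z.im, this, ?_⟩
      rw [hc, Real.log_exp, Complex.re_add_im]
  rw [this]
  apply IsClosed.and
  · exact isClosed_le (by fun_prop) (by fun_prop)
  · exact isClosed_eq (by fun_prop) (by fun_prop)

lemma sSup_crv : sSup {x : ℝ | ∃ z ∈ crv, z.re = x} = Real.log 2 := by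
  apply IsGreatest.csSup_eq
  constructor
  · refine ⟨(Real.log 2 : ℝ), ⟨0, ⟨by linarith [Real.pi_pos], by linarith [Real.pi_pos]⟩, ?_⟩, Complex.ofReal_re _⟩
    simp
  · rintro x ⟨z, hz, rfl⟩
    rw [← range_symb] at hz
    obtain ⟨x, rfl⟩ := hz
    exact symb_re_le x

lemma norm_exp_sub_one_le_half (w : ℂ) (c : ℝ) (hc : 0 ≤ c) (hw : w.re ≤ c) :
    ‖Complex.exp w - 1‖ ≤ Real.exp c * ‖w‖ := by
  have h := Convex.norm_image_sub_le_of_norm_deriv_le (𝕜 := ℂ) (f := Complex.exp) (C := Real.exp c)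
    (s := {z : ℂ | z.re ≤ c}) (x := 0) (y := w) (fun x _ => Complex.differentiable_exp x)
    (fun x hx => by
      rw [Complex.deriv_exp, Complex.norm_exp]
      exact Real.exp_le_exp.2 hx) (convex_halfSpace_re_le c) (by simpa using hc) hw
  simpa using h

variable {E : Type} [NormedAddCommGroup E] [NormedSpace ℂ E]

lemma slope_lim (s : ℂ) : Tendsto (fun t : ℝ => (t:ℂ)⁻¹ * (Complex.exp (t * s) - 1))
    (nhdsWithin 0 (Set.Ioi 0)) (nhds s) := by
  have h : HasDerivAt (fun t : ℝ => Complex.exp (t * s)) s 0 := by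
    have h1 : HasDerivAt (fun t : ℝ => (t:ℂ) * s) s 0 := by
      simpa using (Complex.ofRealCLM.hasDerivAt (x := (0:ℝ))).mul_const s
    simpa using h1.cexp
  rw [hasDerivAt_iff_tendsto_slope_zero] at h
  have h2 := h.mono_left (nhdsWithin_mono (0:ℝ) (fun x (hx : 0 < x) => ne_of_gt hx))
  refine h2.congr fun t => ?_
  simp [Complex.real_smul]

lemma quot_coe (U : L2 ≃ₗᵢ[ℂ] VL2 E) (T : ℝ → (L2 →L[ℂ] L2))
    (hT : ∀ t : ℝ, 0 < t → ∀ f : L2, U (T t f) =ᵐ[volume] fun x => Complex.exp (t * symb x) • U f x)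
    (f : L2) (t : ℝ) (ht : 0 < t) :
    U ((t:ℂ)⁻¹ • (T t f - f)) =ᵐ[volume]
      fun x => ((t:ℂ)⁻¹ * (Complex.exp (t * symb x) - 1)) • U f x := by
  rw [map_smul, map_sub]
  filter_upwards [hT t ht f, Lp.coeFn_smul (t:ℂ)⁻¹ (U (T t f) - U f), Lp.coeFn_sub (U (T t f)) (U f)]
    with x h1 h2 h3
  rw [h2, Pi.smul_apply, h3, Pi.sub_apply, h1, mul_smul, sub_smul, one_smul]

lemma gen_char1 (U : L2 ≃ₗᵢ[ℂ] VL2 E) (T : ℝ → (L2 →L[ℂ] L2))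
    (hT : ∀ t : ℝ, 0 < t → ∀ f : L2, U (T t f) =ᵐ[volume] fun x => Complex.exp (t * symb x) • U f x)
    (A : L2 →ₗ.[ℂ] L2) (hA : IsGeneratorOf T A) (f : L2) (hf : f ∈ A.domain) :
    U (A ⟨f, hf⟩) =ᵐ[volume] fun x => symb x • U f x := by
  have h1 := (hA f).2 hf
  have h2 := (U.continuous.tendsto _).comp h1
  have ht : Tendsto (fun n : ℕ => (1 : ℝ) / ((n:ℝ) + 1)) atTop (nhdsWithin 0 (Set.Ioi 0)) := by
    rw [tendsto_nhdsWithin_iff]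
    refine ⟨tendsto_one_div_add_atTop_nhds_zero_nat, Eventually.of_forall fun n => ?_⟩
    simp only [Set.mem_Ioi]; positivity
  have h3 := tendstoInMeasure_of_tendsto_Lp (h2.comp ht)
  obtain ⟨ns, hns, hae⟩ := h3.exists_seq_tendsto_ae
  have hall : ∀ᵐ x, ∀ n : ℕ, U (((1 / ((n:ℝ)+1) : ℝ):ℂ)⁻¹ • (T (1 / ((n:ℝ)+1)) f - f)) x =
      (((1 / ((n:ℝ)+1) : ℝ):ℂ)⁻¹ * (Complex.exp ((1 / ((n:ℝ)+1) : ℝ) * symb x) - 1)) • U f x := by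
    rw [ae_all_iff]
    intro n
    exact quot_coe U T hT f _ (by positivity)
  filter_upwards [hae, hall] with x hx hy
  have h4 : Tendsto (fun i => (((1 / ((ns i:ℝ)+1) : ℝ):ℂ)⁻¹ *
      (Complex.exp ((1 / ((ns i:ℝ)+1) : ℝ) * symb x) - 1)) • U f x) atTop (nhds (symb x • U f x)) := by
    refine Tendsto.smul_const ?_ _
    exact (slope_lim (symb x)).comp (ht.comp hns.tendsto_atTop)
  refine tendsto_nhds_unique (hx.congr fun i => ?_) h4
  exact hy (ns i)

lemma gen_char2 (U : L2 ≃ₗᵢ[ℂ] VL2 E) (T : ℝ → (L2 →L[ℂ] L2))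
    (hT : ∀ t : ℝ, 0 < t → ∀ f : L2, U (T t f) =ᵐ[volume] fun x => Complex.exp (t * symb x) • U f x)
    (A : L2 →ₗ.[ℂ] L2) (hA : IsGeneratorOf T A) (f : L2) (g : VL2 E)
    (hg : g =ᵐ[volume] fun x => symb x • U f x) : f ∈ A.domain := by
  refine (hA f).1.2 ⟨U.symm g, ?_⟩
  have key : Tendsto (fun t : ℝ => U ((t:ℂ)⁻¹ • (T t f - f))) (nhdsWithin 0 (Set.Ioi 0)) (nhds g) := by
    refine lp_dct _ _ (fun t x => ((t:ℂ)⁻¹ * (Complex.exp (t * symb x) - 1) - symb x) • U f x)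
      (fun x => 3 * ‖g x‖) ((Lp.memLp g).norm.const_mul 3) ?_ ?_ ?_
    · filter_upwards [self_mem_nhdsWithin] with t ht
      filter_upwards [Lp.coeFn_sub (U ((t:ℂ)⁻¹ • (T t f - f))) g, hg, quot_coe U T hT f t ht]
        with x h1 h2 h3
      rw [h1, Pi.sub_apply, h2, h3, sub_smul]
    · filter_upwards [Ioc_mem_nhdsGT (show (0:ℝ) < 1 by norm_num)] with t ht
      filter_upwards [hg] with x hx
      rw [hx, norm_smul, norm_smul, ← mul_assoc]
      gcongr
      have h1 := norm_exp_sub_one_le_half (t * symb x) (Real.log 2) (Real.log_nonneg (by norm_num))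
        (by
          rw [Complex.re_ofReal_mul]
          have h2 := symb_re_le x
          have h3 := Real.log_nonneg (show (1:ℝ) ≤ 2 by norm_num)
          have := ht.1
          calc t * (symb x).re ≤ t * Real.log 2 := by gcongr
            _ ≤ 1 * Real.log 2 := by gcongr; exact ht.2
            _ = _ := one_mul _)
      rw [Real.exp_log (by norm_num), norm_mul, Complex.norm_real, Real.norm_of_nonneg ht.1.le] at h1
      have h4 : ‖(t:ℂ)⁻¹ * (Complex.exp (t * symb x) - 1)‖ ≤ 2 * ‖symb x‖ := by
        rw [norm_mul, norm_inv, Complex.norm_real, Real.norm_of_nonneg ht.1.le]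
        rw [inv_mul_le_iff₀ ht.1]
        linarith
      calc _ ≤ _ := norm_sub_le _ _
        _ ≤ 2 * ‖symb x‖ + ‖symb x‖ := by gcongr
        _ = _ := by ring
    · refine Eventually.of_forall fun x => ?_
      have := ((slope_lim (symb x)).sub_const (symb x)).smul_const (U f x)
      simpa using this
  have := (U.symm.continuous.tendsto _).comp key
  refine this.congr fun t => ?_
  simp

lemma range_lem (U : L2 ≃ₗᵢ[ℂ] VL2 E) (T : ℝ → (L2 →L[ℂ] L2))
    (hT : ∀ t : ℝ, 0 < t → ∀ f : L2, U (T t f) =ᵐ[volume] fun x => Complex.exp (t * symb x) • U f x)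
    (A : L2 →ₗ.[ℂ] L2) (hA : IsGeneratorOf T A) (z : ℂ) (m k : ℝ → ℂ) (hk : Measurable k) (C : ℝ)
    (hC : ∀ x, ‖k x‖ ≤ C) (hmk : ∀ x, (z - symb x) * m x = k x) (f : L2) (h : VL2 E)
    (hf : U f =ᵐ[volume] fun x => m x • h x) :
    ∃ hd : f ∈ A.domain, U (z • f - A ⟨f, hd⟩) = mulOp E k hk C hC h := by
  have hd : f ∈ A.domain := by
    refine gen_char2 U T hT A hA f (z • U f - mulOp E k hk C hC h) ?_
    filter_upwards [hf, mulOp_coe k hk C hC h, Lp.coeFn_sub (z • U f) (mulOp E k hk C hC h),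
      Lp.coeFn_smul z (U f)] with x h1 h2 h3 h4
    rw [h3, Pi.sub_apply, h4, Pi.smul_apply, h2, h1, ← hmk, sub_mul, sub_smul, mul_smul, mul_smul]
    abel
  refine ⟨hd, ?_⟩
  apply Lp.ext
  rw [map_sub, map_smul]
  filter_upwards [hf, mulOp_coe k hk C hC h, Lp.coeFn_sub (z • U f) (U (A ⟨f, hd⟩)),
      Lp.coeFn_smul z (U f), gen_char1 U T hT A hA f hd] with x h1 h2 h3 h4 h5
  rw [h3, Pi.sub_apply, h4, Pi.smul_apply, h2, h5, h1, ← hmk, sub_mul, sub_smul, mul_smul, mul_smul]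

lemma spec_sub (U : L2 ≃ₗᵢ[ℂ] VL2 E) (T : ℝ → (L2 →L[ℂ] L2))
    (hT : ∀ t : ℝ, 0 < t → ∀ f : L2, U (T t f) =ᵐ[volume] fun x => Complex.exp (t * symb x) • U f x)
    (A : L2 →ₗ.[ℂ] L2) (hA : IsGeneratorOf T A) : pmapSpectrum A ⊆ crv := by
  intro z hz
  by_contra hzc
  apply hz
  obtain ⟨δ, hδ, hball⟩ := Metric.isOpen_iff.1 crv_closed.isOpen_compl z hzc
  have hb : ∀ x, δ ≤ ‖z - symb x‖ := by
    intro x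
    by_contra! h
    refine hball (a := symb x) ?_ ?_
    · rw [Metric.mem_ball, dist_comm, dist_eq_norm]; exact h
    · rw [← range_symb]; exact ⟨x, rfl⟩
  have hne : ∀ x, z - symb x ≠ 0 := fun x h => by
    have := hb x
    rw [h, norm_zero] at this
    linarith
  have hm : Measurable (fun x => (z - symb x)⁻¹) := (measurable_const.sub symb_cont.measurable).inv
  have hC : ∀ x, ‖(z - symb x)⁻¹‖ ≤ δ⁻¹ := fun x => by
    rw [norm_inv]; exact inv_anti₀ hδ (hb x)
  set M := mulOp E _ hm _ hC with hM
  refine ⟨(U.symm : VL2 E →L[ℂ] L2) ∘L M ∘L (U : L2 →L[ℂ] VL2 E), ?_, ?_⟩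
  · intro f
    have hf : U (U.symm (M (U f))) =ᵐ[volume] fun x => (z - symb x)⁻¹ • U f x := by
      rw [U.apply_symm_apply]
      exact mulOp_coe _ hm _ hC _
    obtain ⟨hd, h⟩ := range_lem U T hT A hA z _ (fun _ => 1) measurable_const 1 (by simp)
      (fun x => mul_inv_cancel₀ (hne x)) _ _ hf
    refine ⟨hd, ?_⟩
    apply U.injective
    refine Eq.trans h ?_
    apply Lp.ext
    filter_upwards [mulOp_coe (fun _ => (1:ℂ)) measurable_const 1 (by simp) (U f)] with x hx
    rw [hx, one_smul]
  · intro f hf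
    apply U.injective
    simp only [ContinuousLinearMap.comp_apply]
    refine Eq.trans (U.apply_symm_apply _) ?_
    apply Lp.ext
    refine (mulOp_coe _ hm _ hC _).trans ?_
    have e : U (z • f - A ⟨f, hf⟩) = z • U f - U (A ⟨f, hf⟩) := by rw [map_sub, map_smul]
    have e2 : (U : L2 →L[ℂ] VL2 E) (z • f - A ⟨f, hf⟩) = z • U f - U (A ⟨f, hf⟩) := e
    rw [e2]
    filter_upwards [Lp.coeFn_sub (z • U f) (U (A ⟨f, hf⟩)),
      Lp.coeFn_smul z (U f), gen_char1 U T hT A hA f hf] with x h3 h4 h5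
    rw [h3, Pi.sub_apply, h4, Pi.smul_apply, h5, ← sub_smul, smul_smul, inv_mul_cancel₀ (hne x), one_smul]

lemma spec_sup [Nontrivial E] (U : L2 ≃ₗᵢ[ℂ] VL2 E) (T : ℝ → (L2 →L[ℂ] L2))
    (hT : ∀ t : ℝ, 0 < t → ∀ f : L2, U (T t f) =ᵐ[volume] fun x => Complex.exp (t * symb x) • U f x)
    (A : L2 →ₗ.[ℂ] L2) (hA : IsGeneratorOf T A) : crv ⊆ pmapSpectrum A := by
  intro z hz
  rw [← range_symb] at hz
  obtain ⟨x₀, rfl⟩ := hz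
  rintro ⟨R, -, hR⟩
  obtain ⟨e, he⟩ := exists_ne (0:E)
  set ε : ℝ := 1 / (‖R‖ + 1) with hε
  have hε0 : 0 < ε := by positivity
  obtain ⟨δ, hδ, hb⟩ := Metric.continuousAt_iff.1 (symb_cont.continuousAt (x := x₀)) ε hε0
  have hfin : volume (Metric.ball x₀ δ) ≠ ⊤ := measure_ball_lt_top.ne
  have hpos : volume (Metric.ball x₀ δ) ≠ 0 := (Metric.measure_ball_pos _ _ hδ).ne'
  set g : VL2 E := indicatorConstLp 2 Metric.isOpen_ball.measurableSet hfin e with hg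
  have hgc : g =ᵐ[volume] (Metric.ball x₀ δ).indicator fun _ => e := indicatorConstLp_coeFn
  have hg0 : 0 < ‖g‖ := by
    rw [hg, norm_indicatorConstLp (by norm_num) (by norm_num)]
    have : 0 < volume.real (Metric.ball x₀ δ) := ENNReal.toReal_pos hpos hfin
    have := norm_pos_iff.2 he
    positivity
  set k : ℝ → ℂ := (Metric.ball x₀ δ).indicator (fun x => symb x₀ - symb x) with hkdef
  have hk : Measurable k :=
    (measurable_const.sub symb_cont.measurable).indicator Metric.isOpen_ball.measurableSet
  have hkC : ∀ x, ‖k x‖ ≤ ε := by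
    intro x
    rw [hkdef]
    by_cases hx : x ∈ Metric.ball x₀ δ
    · rw [Set.indicator_of_mem hx]
      have := hb hx
      rw [dist_comm, dist_eq_norm] at this
      exact this.le
    · rw [Set.indicator_of_notMem hx, norm_zero]; exact hε0.le
  obtain ⟨hd, h⟩ := range_lem U T hT A hA (symb x₀) ((Metric.ball x₀ δ).indicator 1) k hk ε hkC
    (by
      intro x
      rw [hkdef]
      by_cases hx : x ∈ Metric.ball x₀ δ
      · simp [Set.indicator_of_mem hx]
      · simp [Set.indicator_of_notMem hx]) (U.symm g) g (by
      rw [U.apply_symm_apply]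
      filter_upwards [hgc] with x hx
      rw [hx]
      by_cases hx : x ∈ Metric.ball x₀ δ
      · simp [Set.indicator_of_mem hx]
      · simp [Set.indicator_of_notMem hx])
  have h1 := hR _ hd
  have h2 : ‖g‖ ≤ ‖R‖ * (ε * ‖g‖) := by
    calc ‖g‖ = ‖U.symm g‖ := (U.symm.norm_map g).symm
      _ = ‖R (symb x₀ • U.symm g - A ⟨U.symm g, hd⟩)‖ := by rw [h1]
      _ ≤ ‖R‖ * ‖symb x₀ • U.symm g - A ⟨U.symm g, hd⟩‖ := R.le_opNorm _
      _ = ‖R‖ * ‖mulOp E k hk ε hkC g‖ := by rw [← h, U.norm_map]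
      _ ≤ ‖R‖ * (ε * ‖g‖) := by
        gcongr
        apply Lp.norm_le_mul_norm_of_ae_le_mul
        filter_upwards [mulOp_coe k hk ε hkC g] with x hx
        rw [hx, norm_smul]
        gcongr
        exact hkC x
  have h3 : ‖R‖ * ε < 1 := by
    rw [hε, mul_one_div, div_lt_one (by positivity)]; linarith
  nlinarith

lemma spec_cont (U : L2 ≃ₗᵢ[ℂ] VL2 E) (T : ℝ → (L2 →L[ℂ] L2))
    (hT : ∀ t : ℝ, 0 < t → ∀ f : L2, U (T t f) =ᵐ[volume] fun x => Complex.exp (t * symb x) • U f x)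
    (A : L2 →ₗ.[ℂ] L2) (hA : IsGeneratorOf T A) (z : ℂ) :
    (∀ f : A.domain, A f = z • (f : L2) → (f : L2) = 0) ∧
    Dense (Set.range (fun f : A.domain => z • (f : L2) - A f)) := by
  have hae : ∀ᵐ x : ℝ, symb x ≠ z := by
    have : {x : ℝ | symb x = z}.Subsingleton := fun x hx y hy => symb_inj (hx.trans hy.symm)
    have h0 := this.measure_zero (volume : Measure ℝ)
    rw [ae_iff]
    simpa using h0
  constructor
  · rintro ⟨f, hf⟩ h
    apply U.injective
    rw [map_zero]
    apply Lp.ext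
    have h1 := gen_char1 U T hT A hA f hf
    rw [h, map_smul] at h1
    filter_upwards [hae, h1, Lp.coeFn_smul z (U f), Lp.coeFn_zero E 2 (volume : Measure ℝ)] with x h2 h3 h4 h5
    rw [h5, Pi.zero_apply]
    rw [h4, Pi.smul_apply] at h3
    have : (z - symb x) • U f x = 0 := by rw [sub_smul, h3, sub_self]
    rcases smul_eq_zero.1 this with h | h
    · exact absurd (sub_eq_zero.1 h).symm h2
    · exact h
  · intro h
    set S : ℕ → Set ℝ := fun n => {x | 1 / ((n:ℝ) + 1) < ‖z - symb x‖} with hS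
    have hSm : ∀ n, MeasurableSet (S n) := fun n =>
      (isOpen_lt continuous_const (by have := symb_cont; fun_prop)).measurableSet
    set m : ℕ → ℝ → ℂ := fun n => (S n).indicator (fun x => (z - symb x)⁻¹) with hm
    set k : ℕ → ℝ → ℂ := fun n => (S n).indicator 1 with hk
    have hmm : ∀ n, Measurable (m n) := fun n =>
      ((measurable_const.sub symb_cont.measurable).inv).indicator (hSm n)
    have hkm : ∀ n, Measurable (k n) := fun n => measurable_one.indicator (hSm n)
    have hmC : ∀ n x, ‖m n x‖ ≤ (n:ℝ) + 1 := by
      intro n x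
      by_cases hx : x ∈ S n
      · simp only [hm, Set.indicator_of_mem hx, norm_inv]
        have : 1 / ((n:ℝ) + 1) < ‖z - symb x‖ := hx
        rw [one_div] at this
        exact (inv_lt_of_inv_lt₀ (by positivity) this).le
      · simp only [hm, Set.indicator_of_notMem hx, norm_zero]; positivity
    have hkC : ∀ n x, ‖k n x‖ ≤ 1 := by
      intro n x
      by_cases hx : x ∈ S n
      · simp [hk, Set.indicator_of_mem hx]
      · simp [hk, Set.indicator_of_notMem hx]
    have hmk : ∀ n x, (z - symb x) * m n x = k n x := by
      intro n x
      by_cases hx : x ∈ S n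
      · simp only [hk, hm, Set.indicator_of_mem hx, Pi.one_apply]
        have h1 : 1 / ((n:ℝ) + 1) < ‖z - symb x‖ := hx
        have h2 : 0 < ‖z - symb x‖ := lt_trans (by positivity) h1
        exact mul_inv_cancel₀ (norm_pos_iff.1 h2)
      · simp [hk, hm, Set.indicator_of_notMem hx]
    have hr : ∀ n, ∃ hd : U.symm (mulOp E (m n) (hmm n) _ (hmC n) (U h)) ∈ A.domain,
        U (z • (U.symm (mulOp E (m n) (hmm n) _ (hmC n) (U h))) - A ⟨_, hd⟩) = mulOp E (k n) (hkm n) 1 (hkC n) (U h) := by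
      intro n
      refine range_lem U T hT A hA z (m n) (k n) (hkm n) 1 (hkC n) (hmk n) _ (U h) ?_
      rw [U.apply_symm_apply]
      exact mulOp_coe _ _ _ _ _
    have key : Tendsto (fun n => mulOp E (k n) (hkm n) 1 (hkC n) (U h)) atTop (nhds (U h)) := by
      refine lp_dct _ _ (fun n x => (k n x - 1) • U h x) (fun x => 2 * ‖U h x‖)
        ((Lp.memLp (U h)).norm.const_mul 2) ?_ ?_ ?_
      · refine Eventually.of_forall fun n => ?_
        filter_upwards [mulOp_coe (k n) (hkm n) 1 (hkC n) (U h),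
          Lp.coeFn_sub (mulOp E (k n) (hkm n) 1 (hkC n) (U h)) (U h)] with x h1 h2
        rw [h2, Pi.sub_apply, h1, sub_smul, one_smul]
      · refine Eventually.of_forall fun n => Eventually.of_forall fun x => ?_
        rw [norm_smul]
        gcongr
        refine (norm_sub_le _ _).trans ?_
        have := hkC n x
        rw [norm_one]; linarith
      · filter_upwards [hae] with x hx
        have hpos : 0 < ‖z - symb x‖ := norm_pos_iff.2 (sub_ne_zero.2 hx.symm)
        have hev : ∀ᶠ n : ℕ in atTop, 1 / ((n:ℝ) + 1) < ‖z - symb x‖ :=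
          tendsto_one_div_add_atTop_nhds_zero_nat.eventually_lt_const hpos
        refine tendsto_const_nhds.congr' ?_
        filter_upwards [hev] with n hn
        have hx : x ∈ S n := hn
        simp [hk, Set.indicator_of_mem hx]
    have key2 := (U.symm.continuous.tendsto _).comp key
    rw [U.symm_apply_apply] at key2
    refine mem_closure_of_tendsto key2 (Eventually.of_forall fun n => ?_)
    obtain ⟨hd, he⟩ := hr n
    refine ⟨⟨_, hd⟩, ?_⟩
    apply U.injective
    rw [Function.comp_apply, U.apply_symm_apply]
    exact he

theorem abstract_main [Nontrivial E] (U : L2 ≃ₗᵢ[ℂ] VL2 E) (T : ℝ → (L2 →L[ℂ] L2))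
    (hT : ∀ t : ℝ, 0 < t → ∀ f : L2, U (T t f) =ᵐ[volume] fun x => Complex.exp (t * symb x) • U f x)
    (A : L2 →ₗ.[ℂ] L2) (hA : IsGeneratorOf T A) :
    pmapSpectrum A = pmapContinuousSpectrum A ∧ pmapSpectrum A = crv ∧
    sSup {x : ℝ | ∃ z ∈ pmapSpectrum A, z.re = x} = Real.log 2 := by
  have h : pmapSpectrum A = crv :=
    Set.Subset.antisymm (spec_sub U T hT A hA) (spec_sup U T hT A hA)
  refine ⟨?_, h, ?_⟩
  · ext z
    exact ⟨fun hz => ⟨hz, spec_cont U T hT A hA z⟩, fun hz => hz.1⟩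
  · rw [h]; exact sSup_crv

end generic

open FourierTransform SchwartzMap in
lemma fourier_L2_eq {E : Type} [NormedAddCommGroup E] [InnerProductSpace ℂ E] [CompleteSpace E]
    (h : VL2 E) (hi : Integrable h volume) :
    (Lp.fourierTransformₗᵢ ℝ E h) =ᵐ[volume] 𝓕 (h : ℝ → E) := by
  have hc : Continuous (𝓕 (h : ℝ → E)) :=
    VectorFourier.fourierIntegral_continuous Real.continuous_fourierChar (by exact continuous_inner) hi
  refine ae_eq_of_integral_contDiff_smul_eq
    ((Lp.memLp _).locallyIntegrable (by norm_num)) hc.locallyIntegrable ?_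
  intro g hg hgc
  have hg1 : ContDiff ℝ ((⊤ : ℕ∞) : WithTop ℕ∞) (fun x => (g x : ℂ)) := 
    Complex.ofRealCLM.contDiff.comp hg
  have hg2 : HasCompactSupport (fun x => (g x : ℂ)) := hgc.comp_left (g := fun x : ℝ => (x:ℂ)) (by simp)
  set φ : 𝓢(ℝ, ℂ) := hg2.toSchwartzMap hg1 with hφ
  have hφx : ∀ x, φ x = (g x : ℂ) := fun x => rfl
  have h1 := congrArg (fun D => D φ) (Lp.fourier_toTemperedDistribution_eq h)
  simp only [TemperedDistribution.fourier_apply, Lp.toTemperedDistribution_apply] at h1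
  have h2 : ∫ x, (𝓕 (φ : ℝ → ℂ)) x • h x = ∫ x, φ x • 𝓕 (h : ℝ → E) x := by
    have := VectorFourier.integral_fourierIntegral_smul_eq_flip (L := innerₗ ℝ) (μ := volume)
      (ν := volume) (f := φ) (g := h) Real.continuous_fourierChar
      (by exact continuous_inner) φ.integrable hi
    rw [flip_innerₗ] at this
    exact this
  rw [← SchwartzMap.fourier_coe] at h2
  have h3 := h1.symm.trans h2
  exact h3

lemma laplace_gamma (t : ℝ) (ht : 0 < t) (s : ℂ) (hs : 0 < s.re) :
    ∫ r : ℝ in Set.Ioi 0, (r:ℂ) ^ ((t:ℂ) - 1) * Complex.exp (-(s * r)) =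
      Complex.exp (-(t * Complex.log s)) * Complex.Gamma t := by
  have hdm : Measurable (fun r : ℝ => r ^ (t - 1)) := by fun_prop
  set μ : Measure ℝ := (volume.restrict (Set.Ioi 0)).withDensity
    (fun r => ENNReal.ofReal (r ^ (t - 1))) with hμ
  have hI : Set.Iio (0:ℝ) ⊆ ProbabilityTheory.integrableExpSet id μ := by
    intro x hx
    have hx : x < 0 := hx
    change Integrable (fun r : ℝ => Real.exp (x * id r)) μ
    rw [hμ, integrable_withDensity_iff_integrable_smul' (by fun_prop) (Eventually.of_forall fun _ => ENNReal.ofReal_lt_top)]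
    have := integrableOn_rpow_mul_exp_neg_mul_rpow (p := 1) (s := t - 1) (b := -x) (by linarith) (by norm_num) (by linarith)
    refine this.congr ?_
    filter_upwards [ae_restrict_mem measurableSet_Ioi] with r hr
    have hr : 0 < r := hr
    rw [ENNReal.toReal_ofReal (by positivity)]
    simp
  have hmgf : ∀ z : ℂ, ProbabilityTheory.complexMGF id μ z =
      ∫ r : ℝ in Set.Ioi 0, (r:ℂ) ^ ((t:ℂ) - 1) * Complex.exp (z * r) := by
    intro z
    rw [ProbabilityTheory.complexMGF, hμ, integral_withDensity_eq_integral_toReal_smul (by fun_prop) (Eventually.of_forall fun _ => ENNReal.ofReal_lt_top)]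
    refine setIntegral_congr_fun measurableSet_Ioi fun r hr => ?_
    have hr : 0 < r := hr
    dsimp
    rw [ENNReal.toReal_ofReal (by positivity), Complex.ofReal_cpow hr.le]
    simp
  have hopen : IsOpen {s : ℂ | 0 < s.re} := isOpen_lt continuous_const Complex.continuous_re
  have hf : AnalyticOnNhd ℂ (fun s => ProbabilityTheory.complexMGF id μ (-s)) {s : ℂ | 0 < s.re} := by
    apply DifferentiableOn.analyticOnNhd _ hopen
    intro s hs
    have hs : 0 < s.re := hs
    have : (-s).re ∈ interior (ProbabilityTheory.integrableExpSet id μ) := by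
      rw [mem_interior]
      exact ⟨_, hI, isOpen_Iio, by simpa using hs⟩
    have h1 := (ProbabilityTheory.hasDerivAt_complexMGF this)
    exact (h1.comp s (hasDerivAt_neg s)).differentiableAt.differentiableWithinAt
  have hg : AnalyticOnNhd ℂ (fun s => Complex.exp (-(t * Complex.log s)) * Complex.Gamma t) {s : ℂ | 0 < s.re} := by
    apply DifferentiableOn.analyticOnNhd _ hopen
    intro s hs
    have hs : 0 < s.re := hs
    have : DifferentiableAt ℂ Complex.log s := Complex.differentiableAt_log (Or.inl hs)
    exact ((((this.const_mul (t:ℂ)).neg).cexp).mul_const _).differentiableWithinAt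
  have hreal : ∀ x : ℝ, 0 < x → ProbabilityTheory.complexMGF id μ (-(x:ℂ)) =
      Complex.exp (-(t * Complex.log x)) * Complex.Gamma t := by
    intro x hx
    rw [hmgf]
    simp_rw [neg_mul]
    rw [Complex.integral_cpow_mul_exp_neg_mul_Ioi (by simpa using ht) hx, one_div,
      Complex.cpow_def_of_ne_zero (by simp [hx.ne']), ← Complex.ofReal_inv, ← Complex.ofReal_log (by positivity),
      Real.log_inv, ← Complex.ofReal_log hx.le]
    congr 2
    push_cast; ring
  have heq := hf.eqOn_of_preconnected_of_frequently_eq hg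
    (convex_halfSpace_re_gt 0).isPreconnected (z₀ := 1) (by simp) (by
      have h1 : Tendsto (fun n : ℕ => (((1 + 1 / ((n:ℝ) + 1) : ℝ)) : ℂ)) atTop (nhdsWithin 1 {1}ᶜ) := by
        rw [tendsto_nhdsWithin_iff]
        constructor
        · have := (tendsto_one_div_add_atTop_nhds_zero_nat (𝕜 := ℝ)).const_add 1
          rw [add_zero] at this
          exact (Complex.continuous_ofReal.tendsto _).comp this
        · refine Eventually.of_forall fun n h => ?_
          have h : (((1 + 1 / ((n:ℝ) + 1) : ℝ)) : ℂ) = 1 := h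
          have h2 : (1 + 1 / ((n:ℝ) + 1) : ℝ) = 1 := by exact_mod_cast h
          have : 0 < 1 / ((n:ℝ) + 1) := by positivity
          linarith
      refine h1.frequently (Frequently.of_forall fun n => ?_)
      exact hreal _ (by positivity))
  have := heq hs
  simp only [hmgf] at this
  simpa [neg_mul] using this

/-- convolution kernel -/
def kern (t : ℝ) : ℝ → ℂ := (Set.Ioi (0:ℝ)).indicator fun r =>
  (Complex.Gamma t)⁻¹ * (r:ℂ) ^ ((t:ℂ) - 1) * Complex.exp (-(1/2 * r))

lemma kern_integrable (t : ℝ) (ht : 0 < t) : Integrable (kern t) volume := by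
  rw [kern, integrable_indicator_iff measurableSet_Ioi]
  have h := integrableOn_rpow_mul_exp_neg_mul_rpow (p := 1) (s := t - 1) (b := 1/2) (by linarith) (by norm_num) (by norm_num)
  have h2 := (h.ofReal (𝕜 := ℂ)).const_mul (Complex.Gamma t)⁻¹
  refine h2.congr ?_
  filter_upwards [ae_restrict_mem measurableSet_Ioi] with r hr
  have hr : 0 < r := hr
  simp only [RCLike.ofReal_mul, Real.rpow_one, mul_assoc]
  simp only [Complex.coe_algebraMap, Complex.ofReal_cpow hr.le]
  push_cast
  simp [Complex.ofReal_cpow hr.le]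

open FourierTransform in
lemma kern_fourier (t : ℝ) (ht : 0 < t) (ξ : ℝ) : 𝓕 (kern t) ξ = Complex.exp (t * symb ξ) := by
  rw [Real.fourier_real_eq_integral_exp_smul, symb]
  have h := laplace_gamma t ht (1/2 + 2 * Real.pi * ξ * I) (by rw [symb_arg_re]; norm_num)
  have hG : Complex.Gamma t ≠ 0 := Complex.Gamma_ne_zero_of_re_pos (by simpa using ht)
  have e : ∀ r : ℝ, Complex.exp (((-2 * Real.pi * r * ξ : ℝ) : ℂ) * I) • kern t r =
      (Set.Ioi (0:ℝ)).indicator (fun r => (Complex.Gamma t)⁻¹ * ((r:ℂ) ^ ((t:ℂ) - 1) *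
        Complex.exp (-((1/2 + 2 * Real.pi * ξ * I) * r)))) r := by
    intro r
    rw [kern]
    by_cases hr : r ∈ Set.Ioi (0:ℝ)
    · rw [Set.indicator_of_mem hr, Set.indicator_of_mem hr, smul_eq_mul]
      have : Complex.exp (-((1/2 + 2 * Real.pi * ξ * I) * r)) =
        Complex.exp (((-2 * Real.pi * r * ξ : ℝ) : ℂ) * I) * Complex.exp (-(1/2 * r)) := by
        rw [← Complex.exp_add]; congr 1; push_cast; ring
      rw [this]; ring
    · rw [Set.indicator_of_notMem hr, Set.indicator_of_notMem hr, smul_zero]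
  simp_rw [e]
  rw [integral_indicator measurableSet_Ioi, integral_const_mul, h, mul_comm, mul_assoc,
    mul_inv_cancel₀ hG, mul_one, mul_neg]


/-- the fibre -/
abbrev E2 : Type := EuclideanSpace ℂ (Fin 2)

/-- substitution -/
def wfun (f : ℝ → ℂ) (s : ℝ) : E2 :=
  !₂[(Real.exp (s/2) : ℂ) * f (1 * Real.exp s), (Real.exp (s/2) : ℂ) * f (-1 * Real.exp s)]

lemma lint_sub (σ : ℝ) (hσ : |σ| = 1) (S : Set ℝ) (hS : (fun s => σ * Real.exp s) '' Set.univ = S)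
    (g : ℝ → ENNReal) :
    ∫⁻ x in S, g x = ∫⁻ s, ENNReal.ofReal (Real.exp s) * g (σ * Real.exp s) := by
  have hσ0 : σ ≠ 0 := by rintro rfl; simp at hσ
  have := lintegral_image_eq_lintegral_abs_deriv_mul (s := Set.univ) (f := fun s => σ * Real.exp s)
    (f' := fun s => σ * Real.exp s) MeasurableSet.univ
    (fun x _ => ((Real.hasDerivAt_exp x).const_mul σ).hasDerivWithinAt)
    (fun x _ y _ h => by
      have h : σ * Real.exp x = σ * Real.exp y := h
      exact Real.exp_injective (mul_left_cancel₀ hσ0 h)) g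
  rw [hS, Measure.restrict_univ] at this
  rw [this]
  congr 1
  ext s
  rw [abs_mul, hσ, one_mul, Real.abs_exp]

lemma img_pos : (fun s => (1:ℝ) * Real.exp s) '' Set.univ = Set.Ioi 0 := by
  ext x
  simp only [one_mul, Set.image_univ, Real.range_exp]

lemma img_neg : (fun s => (-1:ℝ) * Real.exp s) '' Set.univ = Set.Iio 0 := by
  ext x
  simp only [Set.image_univ, Set.mem_range, Set.mem_Iio]
  constructor
  · rintro ⟨y, rfl⟩
    have := Real.exp_pos y
    linarith
  · intro hx
    refine ⟨Real.log (-x), ?_⟩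
    rw [Real.exp_log (by linarith)]; ring

lemma qmp_sub (σ : ℝ) (hσ : |σ| = 1) :
    Measure.QuasiMeasurePreserving (fun s : ℝ => σ * Real.exp s) volume volume := by
  have hm : Measurable (fun s : ℝ => σ * Real.exp s) := by fun_prop
  refine ⟨hm, Measure.AbsolutelyContinuous.mk fun N hN hN0 => ?_⟩
  rw [Measure.map_apply hm hN]
  have h1 := lint_sub σ hσ _ rfl (N.indicator 1)
  have h2 : ∫⁻ x in ((fun s => σ * Real.exp s) '' Set.univ), N.indicator 1 x = 0 := by
    refine le_antisymm ?_ bot_le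
    calc _ ≤ ∫⁻ x, N.indicator 1 x := setLIntegral_le_lintegral _ _
      _ = 0 := by rw [lintegral_indicator_one hN, hN0]
  rw [h2] at h1
  have h3 := (lintegral_eq_zero_iff (by
    have : Measurable (N.indicator (1 : ℝ → ENNReal)) := measurable_one.indicator hN
    fun_prop)).1 h1.symm
  rw [measure_eq_zero_iff_ae_notMem]
  filter_upwards [h3] with s hs hmem
  have hmem : σ * Real.exp s ∈ N := hmem
  simp [Set.indicator_of_mem hmem] at hs
  linarith [Real.exp_pos s]

lemma wfun_congr {f g : ℝ → ℂ} (h : f =ᵐ[volume] g) : wfun f =ᵐ[volume] wfun g := by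
  filter_upwards [(qmp_sub 1 (by simp)).ae_eq_comp h, (qmp_sub (-1) (by simp)).ae_eq_comp h]
    with s h1 h2
  simp only [Function.comp_apply] at h1 h2
  rw [wfun, wfun, h1, h2]

lemma wfun_meas {f : ℝ → ℂ} (h : AEStronglyMeasurable f volume) :
    AEStronglyMeasurable (wfun f) volume := by
  have h1 := h.comp_quasiMeasurePreserving (qmp_sub 1 (by simp))
  have h2 := h.comp_quasiMeasurePreserving (qmp_sub (-1) (by simp))
  have he : AEStronglyMeasurable (fun s : ℝ => (Real.exp (s/2) : ℂ)) volume :=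
    (by fun_prop : Continuous fun s : ℝ => (Real.exp (s/2) : ℂ)).aestronglyMeasurable
  have hT : Continuous (fun p : ℂ × ℂ => (!₂[p.1, p.2] : E2)) := by fun_prop
  exact hT.comp_aestronglyMeasurable ((he.mul h1).prodMk (he.mul h2))

lemma wfun_enorm (f : ℝ → ℂ) (s : ℝ) : ‖wfun f s‖ₑ ^ (2:ℝ) =
    ENNReal.ofReal (Real.exp s) * ‖f (1 * Real.exp s)‖ₑ ^ (2:ℝ) +
    ENNReal.ofReal (Real.exp s) * ‖f (-1 * Real.exp s)‖ₑ ^ (2:ℝ) := by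
  have h : ‖wfun f s‖ ^ 2 = Real.exp s * ‖f (1 * Real.exp s)‖ ^ 2 + Real.exp s * ‖f (-1 * Real.exp s)‖ ^ 2 := by
    rw [EuclideanSpace.norm_sq_eq]
    have e : Real.exp s = Real.exp (s/2) ^ 2 := by rw [← Real.exp_nat_mul]; congr 1; push_cast; ring
    simp only [wfun, Fin.sum_univ_two, PiLp.toLp_apply, Matrix.cons_val_zero, Matrix.cons_val_one, norm_mul, mul_pow]
    rw [Complex.norm_real, Real.norm_of_nonneg (Real.exp_pos _).le, ← e]
  have e : ∀ {F : Type} [NormedAddCommGroup F] (x : F), ‖x‖ₑ ^ (2:ℝ) = ENNReal.ofReal (‖x‖ ^ 2) := by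
    intro F _ x
    rw [← ofReal_norm, ENNReal.ofReal_rpow_of_nonneg (norm_nonneg _) (by norm_num)]
    norm_num
  rw [e, e, e, h, ← ENNReal.ofReal_mul (Real.exp_pos s).le, ← ENNReal.ofReal_mul (Real.exp_pos s).le,
    ENNReal.ofReal_add (by positivity) (by positivity)]

lemma wfun_eLpNorm {f : ℝ → ℂ} (h : AEStronglyMeasurable f volume) :
    eLpNorm (wfun f) 2 volume = eLpNorm f 2 volume := by
  rw [eLpNorm_eq_lintegral_rpow_enorm_toReal (by norm_num) (by norm_num),
    eLpNorm_eq_lintegral_rpow_enorm_toReal (by norm_num) (by norm_num)]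
  congr 1
  simp only [ENNReal.toReal_ofNat]
  simp_rw [wfun_enorm]
  rw [lintegral_add_left']
  · rw [← lint_sub 1 (by simp) _ img_pos (fun x => ‖f x‖ₑ ^ (2:ℝ)),
      ← lint_sub (-1) (by simp) _ img_neg (fun x => ‖f x‖ₑ ^ (2:ℝ))]
    have h3 : ∫⁻ x in Set.Iio (0:ℝ), ‖f x‖ₑ ^ (2:ℝ) = ∫⁻ x in (Set.Ioi (0:ℝ))ᶜ, ‖f x‖ₑ ^ (2:ℝ) := by
      rw [Set.compl_Ioi]; exact setLIntegral_congr Iio_ae_eq_Iic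
    rw [h3, lintegral_add_compl _ measurableSet_Ioi]
  · have h1 := h.comp_quasiMeasurePreserving (qmp_sub 1 (by simp))
    refine AEMeasurable.mul (by fun_prop) ?_
    exact (h1.enorm.pow_const 2)

lemma wfun_memLp {f : ℝ → ℂ} (h : MemLp f 2 volume) : MemLp (wfun f) 2 volume :=
  ⟨wfun_meas h.1, by rw [wfun_eLpNorm h.1]; exact h.2⟩

/-- The substitution as a linear isometry. -/
def wLin : L2 →ₗᵢ[ℂ] VL2 E2 where
  toFun f := (wfun_memLp (Lp.memLp f)).toLp _
  map_add' f g := by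
    apply Lp.ext
    filter_upwards [MemLp.coeFn_toLp (wfun_memLp (Lp.memLp (f + g))),
      MemLp.coeFn_toLp (wfun_memLp (Lp.memLp f)), MemLp.coeFn_toLp (wfun_memLp (Lp.memLp g)),
      Lp.coeFn_add ((wfun_memLp (Lp.memLp f)).toLp _) ((wfun_memLp (Lp.memLp g)).toLp _),
      wfun_congr (Lp.coeFn_add f g)] with s h1 h2 h3 h4 h5
    rw [h1, h4, Pi.add_apply, h2, h3, h5]
    ext i
    fin_cases i <;> simp [wfun, mul_add]
  map_smul' c f := by
    apply Lp.ext
    filter_upwards [MemLp.coeFn_toLp (wfun_memLp (Lp.memLp (c • f))),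
      MemLp.coeFn_toLp (wfun_memLp (Lp.memLp f)),
      Lp.coeFn_smul c ((wfun_memLp (Lp.memLp f)).toLp _),
      wfun_congr (Lp.coeFn_smul c f)] with s h1 h2 h4 h5
    rw [h1, RingHom.id_apply, h4, Pi.smul_apply, h2, h5]
    ext i
    fin_cases i <;> simp [wfun] <;> ring
  norm_map' f := by
    simp only [LinearMap.coe_mk, AddHom.coe_mk]
    rw [Lp.norm_toLp, wfun_eLpNorm (Lp.aestronglyMeasurable f), Lp.norm_def]

/-- inverse substitution -/
def winv (g : ℝ → E2) (x : ℝ) : ℂ :=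
  (Real.exp (-(Real.log x) / 2) : ℂ) * (if 0 < x then g (Real.log x) 0 else g (Real.log x) 1)

lemma wfun_winv (g : ℝ → E2) : wfun (winv g) = g := by
  ext s i
  have h1 : (Real.exp (s/2) : ℂ) * (Real.exp (-s/2) : ℂ) = 1 := by
    rw [← Complex.ofReal_mul, ← Real.exp_add]
    ring_nf; simp
  have h2 : ¬ (0 < -Real.exp s) := by have := Real.exp_pos s; linarith
  fin_cases i
  · simp only [wfun, winv, Fin.zero_eta, PiLp.toLp_apply, Matrix.cons_val_zero, one_mul, Real.log_exp, Real.exp_pos, if_true]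
    rw [← mul_assoc, h1, one_mul]
  · simp only [wfun, winv, Fin.mk_one, PiLp.toLp_apply, Matrix.cons_val_one, neg_mul, one_mul, Real.log_neg_eq_log, Real.log_exp, h2, if_false]
    rw [← mul_assoc, h1, one_mul]
    rfl

lemma winv_meas {g : ℝ → E2} (h : StronglyMeasurable g) : Measurable (winv g) := by
  have hm := h.measurable
  have h0 : ∀ i : Fin 2, Measurable (fun x : ℝ => g (Real.log x) i) := by
    intro i
    have : Measurable (fun v : E2 => v i) := by fun_prop
    exact this.comp (hm.comp Real.measurable_log)
  unfold winv
  refine Measurable.mul (by fun_prop) ?_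
  exact Measurable.ite measurableSet_Ioi (h0 0) (h0 1)

lemma wLin_coe (f : L2) : wLin f =ᵐ[volume] wfun f := MemLp.coeFn_toLp (wfun_memLp (Lp.memLp f))

lemma wLin_surj : Function.Surjective wLin := by
  intro g
  have hm : AEStronglyMeasurable (winv g) volume :=
    (winv_meas (Lp.stronglyMeasurable g)).aestronglyMeasurable
  have hL : MemLp (winv g) 2 volume :=
    ⟨hm, by rw [← wfun_eLpNorm hm, wfun_winv]; exact (Lp.memLp g).2⟩
  refine ⟨hL.toLp _, ?_⟩
  apply Lp.ext
  refine (wLin_coe _).trans ((wfun_congr hL.coeFn_toLp).trans ?_)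
  rw [wfun_winv]

/-- The substitution as a unitary. -/
def wEquiv : L2 ≃ₗᵢ[ℂ] VL2 E2 := LinearIsometryEquiv.ofSurjective wLin wLin_surj

lemma wEquiv_coe (f : L2) : wEquiv f =ᵐ[volume] wfun f := wLin_coe f

lemma holder_subst (t : ℝ) (F : ℝ → ℂ) (σ s : ℝ) :
    (Real.exp (s/2) : ℂ) * ∫ u : ℝ, holderKernel t u * F (u * (σ * Real.exp s)) =
    ∫ r : ℝ, kern t r * ((Real.exp ((s - r)/2) : ℂ) * F (σ * Real.exp (s - r))) := by
  have himg : (fun r : ℝ => Real.exp (-r)) '' Set.Ioi 0 = Set.Ioo 0 1 := by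
    ext x
    constructor
    · rintro ⟨r, hr, rfl⟩
      have hr : 0 < r := hr
      exact ⟨Real.exp_pos _, by rw [← Real.exp_zero]; exact Real.exp_lt_exp.2 (by linarith)⟩
    · rintro ⟨h0, h1⟩
      exact ⟨-Real.log x, by simpa using Real.log_neg h0 h1, by simp [Real.exp_log h0]⟩
  have h1 : ∫ u : ℝ, holderKernel t u * F (u * (σ * Real.exp s)) =
      ∫ u in Set.Ioo (0:ℝ) 1, (Complex.Gamma t)⁻¹ * ((Real.log u⁻¹ : ℝ) : ℂ) ^ ((t:ℂ) - 1) * F (u * (σ * Real.exp s)) := by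
    rw [← integral_indicator measurableSet_Ioo]
    congr 1
    ext u
    by_cases hu : u ∈ Set.Ioo (0:ℝ) 1
    · rw [Set.indicator_of_mem hu, holderKernel, if_pos hu]
    · rw [Set.indicator_of_notMem hu, holderKernel, if_neg hu, zero_mul]
  have h2 := integral_image_eq_integral_abs_deriv_smul (s := Set.Ioi (0:ℝ)) (f := fun r => Real.exp (-r))
    (f' := fun r => Real.exp (-r) * (-1)) measurableSet_Ioi
    (fun x _ => ((hasDerivAt_neg x).exp).hasDerivWithinAt)
    (fun x _ y _ h => by
      have h : Real.exp (-x) = Real.exp (-y) := h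
      exact neg_injective (Real.exp_injective h))
    (fun u => (Complex.Gamma t)⁻¹ * ((Real.log u⁻¹ : ℝ) : ℂ) ^ ((t:ℂ) - 1) * F (u * (σ * Real.exp s)))
  rw [himg] at h2
  rw [h1, h2, ← integral_const_mul, ← integral_indicator measurableSet_Ioi]
  congr 1
  ext r
  rw [kern]
  by_cases hr : r ∈ Set.Ioi (0:ℝ)
  · rw [Set.indicator_of_mem hr, Set.indicator_of_mem hr]
    have e1 : Real.exp (-r) * (σ * Real.exp s) = σ * Real.exp (s - r) := by
      rw [sub_eq_add_neg, Real.exp_add]; ring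
    have e2 : |Real.exp (-r) * (-1)| = Real.exp (-r) := by rw [mul_neg_one, abs_neg, Real.abs_exp]
    have e3 : Real.log (Real.exp (-r))⁻¹ = r := by rw [Real.log_inv, Real.log_exp, neg_neg]
    have e4 : (Real.exp (s/2) : ℂ) * (Real.exp (-r) : ℂ) = Complex.exp (-(1/2 * r)) * (Real.exp ((s - r)/2) : ℂ) := by
      push_cast
      rw [← Complex.exp_add, ← Complex.exp_add]
      congr 1; ring
    rw [e1, e2, e3, Complex.real_smul]
    linear_combination ((Complex.Gamma t)⁻¹ * (r:ℂ) ^ ((t:ℂ) - 1) * F (σ * Real.exp (s - r))) * e4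
  · rw [Set.indicator_of_notMem hr, Set.indicator_of_notMem hr, zero_mul]

open SchwartzMap Convolution in
lemma conv_schwartz (t : ℝ) (ht : 0 < t) (T : L2 →L[ℂ] L2) (hT : IsHausdorffOp (holderKernel t) T)
    (f : L2) (g : 𝓢(ℝ, E2)) (hfg : wEquiv f = g.toLp 2) :
    wEquiv (T f) =ᵐ[volume] (kern t ⋆[ContinuousLinearMap.lsmul ℂ ℂ] (g : ℝ → E2)) := by
  have hwg : wfun f =ᵐ[volume] g := by
    refine (wEquiv_coe f).symm.trans ?_
    rw [hfg]
    exact g.coeFn_toLp 2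
  have q1 := (qmp_sub 1 (by simp)).ae (hT f)
  have q2 := (qmp_sub (-1) (by simp)).ae (hT f)
  filter_upwards [wEquiv_coe (T f), q1, q2] with s h0 h1 h2
  rw [h0, MeasureTheory.convolution]
  have hintg : Integrable (fun r => (ContinuousLinearMap.lsmul ℂ ℂ) (kern t r) (g (s - r))) volume := by
    simp only [ContinuousLinearMap.lsmul_apply]
    obtain ⟨C, hC⟩ := g.decay 0 0
    refine (kern_integrable t ht).smul_bdd (C := C) ?_ ?_
    · exact (g.continuous.comp (by fun_prop)).aestronglyMeasurable
    · refine Eventually.of_forall fun r => ?_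
      simpa using hC.2 (s - r)
  have hae : ∀ᵐ r, wfun f (s - r) = g (s - r) :=
    (Measure.measurePreserving_sub_left volume s).quasiMeasurePreserving.ae hwg
  ext i
  have hi := (EuclideanSpace.proj (𝕜 := ℂ) i).integral_comp_comm hintg
  refine Eq.trans ?_ hi
  have e : ∫ r, (EuclideanSpace.proj (𝕜 := ℂ) i) ((ContinuousLinearMap.lsmul ℂ ℂ) (kern t r) (g (s - r))) =
      ∫ r, kern t r * (wfun f (s - r)) i := by
    apply integral_congr_ae
    filter_upwards [hae] with r hr
    rw [hr]
    simp
  rw [e]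
  fin_cases i
  · have := holder_subst t f 1 s
    rw [← h1] at this
    simpa [wfun] using this
  · have := holder_subst t f (-1) s
    rw [← h2] at this
    simpa [wfun] using this

/-- the full unitary -/
def uEquiv : L2 ≃ₗᵢ[ℂ] VL2 E2 := wEquiv.trans (Lp.fourierTransformₗᵢ ℝ E2)

lemma exp_symb_bound (t : ℝ) (ht : 0 < t) (x : ℝ) :
    ‖Complex.exp (t * symb x)‖ ≤ Real.exp (t * Real.log 2) := by
  rw [Complex.norm_exp, Complex.re_ofReal_mul]
  gcongr
  exact symb_re_le x

lemma exp_symb_meas (t : ℝ) : Measurable (fun x => Complex.exp (t * symb x)) := by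
  have := symb_cont.measurable
  fun_prop

open SchwartzMap FourierTransform in
lemma intertwine_schwartz (t : ℝ) (ht : 0 < t) (T : L2 →L[ℂ] L2)
    (hT : IsHausdorffOp (holderKernel t) T) (f : L2) (g : 𝓢(ℝ, E2)) (hg : wEquiv f = g.toLp 2) :
    uEquiv (T f) =ᵐ[volume] fun x => Complex.exp (t * symb x) • uEquiv f x := by
  have hc := conv_schwartz t ht T hT f g hg
  have hci := (kern_integrable t ht).integrable_convolution (ContinuousLinearMap.lsmul ℂ ℂ)
    g.integrable (μ := volume)
  have h1 := fourier_L2_eq (wEquiv (T f)) (hci.congr hc.symm)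
  have hgc : wEquiv f =ᵐ[volume] g := by
    rw [hg]; exact g.coeFn_toLp 2
  have h2 := fourier_L2_eq (wEquiv f) (g.integrable.congr hgc.symm)
  have e : ∀ f, uEquiv f = Lp.fourierTransformₗᵢ ℝ E2 (wEquiv f) := fun f => rfl
  rw [e, e]
  filter_upwards [h1, h2] with x a1 a2
  refine Eq.trans a1 ?_
  refine Eq.trans ?_ (congrArg (fun v => Complex.exp (t * symb x) • v) a2.symm)
  rw [Real.fourier_congr_ae hc, Real.fourier_congr_ae hgc,
    Real.fourier_smul_convolution_eq (kern_integrable t ht) g.integrable, kern_fourier t ht]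

open SchwartzMap in
lemma intertwine (t : ℝ) (ht : 0 < t) (T : L2 →L[ℂ] L2) (hT : IsHausdorffOp (holderKernel t) T)
    (f : L2) : uEquiv (T f) =ᵐ[volume] fun x => Complex.exp (t * symb x) • uEquiv f x := by
  obtain ⟨M, hM⟩ : ∃ M : VL2 E2 →L[ℂ] VL2 E2, ∀ h : VL2 E2,
      M h =ᵐ[volume] fun x => Complex.exp (t * symb x) • h x :=
    ⟨mulOp E2 _ (exp_symb_meas t) _ (exp_symb_bound t ht),
      fun h => mulOp_coe _ (exp_symb_meas t) _ (exp_symb_bound t ht) h⟩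
  suffices h : ∀ g : VL2 E2, uEquiv (T (wEquiv.symm g)) = M (uEquiv (wEquiv.symm g)) by
    have h1 := h (wEquiv f)
    rw [wEquiv.symm_apply_apply] at h1
    rw [h1]
    exact hM _
  have hd := SchwartzMap.denseRange_toLpCLM (E := ℝ) (F := E2) (p := 2) (μ := volume)
    ENNReal.ofNat_ne_top
  have hcl : IsClosed {g : VL2 E2 | uEquiv (T (wEquiv.symm g)) = M (uEquiv (wEquiv.symm g))} := by
    apply isClosed_eq
    · exact uEquiv.continuous.comp (T.continuous.comp wEquiv.symm.continuous)
    · exact M.continuous.comp (uEquiv.continuous.comp wEquiv.symm.continuous)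
  intro g
  refine hd.induction_on
    (p := fun g => uEquiv (T (wEquiv.symm g)) = M (uEquiv (wEquiv.symm g))) g hcl ?_
  intro g
  rw [SchwartzMap.toLpCLM_apply]
  apply Lp.ext
  exact (intertwine_schwartz t ht T hT _ g (wEquiv.apply_symm_apply _)).trans (hM _).symm

/-- The spectrum of `log C`, the generator of the Hölder semigroup
on `L²(ℝ)`, coincides with its continuous spectrum and equals the curve
`{log(2 cos y) + i y : y ∈ (-π/2, π/2)}`; in particular its spectral bound
`sup {Re z : z ∈ σ(log C)}` equals `log 2`. -/
theorem stmt13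
    (H : ℂ → (L2 →L[ℂ] L2)) (hH0 : H 0 = 1)
    (hHdef : ∀ α : ℂ, 0 < α.re → IsHausdorffOp (holderKernel α) (H α))
    (A : L2 →ₗ.[ℂ] L2) (hA : IsGeneratorOf (fun t : ℝ => H (t : ℂ)) A) :
    pmapSpectrum A = pmapContinuousSpectrum A ∧
    pmapSpectrum A = {z : ℂ | ∃ y ∈ Set.Ioo (-(Real.pi/2)) (Real.pi/2),
      z = ((Real.log (2 * Real.cos y) : ℝ) : ℂ) + (y : ℂ) * Complex.I} ∧
    sSup {x : ℝ | ∃ z ∈ pmapSpectrum A, z.re = x} = Real.log 2 := by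
  exact abstract_main uEquiv (fun t : ℝ => H (t : ℂ))
    (fun t ht f => intertwine t ht (H t) (hHdef t (by simpa using ht)) f) A hA
end
end
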